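/- arXiv:math/9910035 — 3 statements merged into one kernel-verified Lean document; each statement's English description precedes it below -/
import Mathlib

section
/- Let H be a Hopf algebra over a field K with antipode S, let (A, ρ*) be a right H-comodule algebra and (B, λ*) a left H-comodule algebra, and let γ* : A ⊗ B → H ⊗ A ⊗ B be the left H-comodule structure map given by γ*(a ⊗ b) = Σ S(a_1)b_{−1} ⊗ a_0 ⊗ b_0, where ρ*(a) = Σ a_0 ⊗ a_1 and λ*(b) = Σ b_{−1} ⊗ b_0. If v ∈ A ⊗ B satisfies γ*(v) = z ⊗ v for some central element z ∈ H, then for every w ∈ A ⊗ B one has γ*(vw) = γ*(v)γ*(w), the product on the right being taken in the algebra H ⊗ A ⊗ B. In particular this holds when v is a γ*-coinvariant (the case z = 1). -/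
open scoped TensorProduct

noncomputable section

/-- The left `H`-comodule structure map `γ* : A ⊗ B → H ⊗ (A ⊗ B)` given on pure tensors by
`γ*(a ⊗ b) = Σ S(a₁) b₋₁ ⊗ a₀ ⊗ b₀`, built from a right coaction `ρ* : A → A ⊗ H` and a left
coaction `λ* : B → H ⊗ B` and the antipode `S` of `H`. -/
def gammaMap (K A B H : Type) [Field K] [Ring A] [Algebra K A] [Ring B] [Algebra K B]
    [Ring H] [HopfAlgebra K H]
    (ρ : A →ₐ[K] A ⊗[K] H) (lam : B →ₐ[K] H ⊗[K] B) :
    (A ⊗[K] B) →ₗ[K] H ⊗[K] (A ⊗[K] B) :=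
  (TensorProduct.map
      ((LinearMap.mul' K H).comp
        (TensorProduct.map (HopfAlgebra.antipode (R := K)) LinearMap.id))
      LinearMap.id)
    ∘ₗ (TensorProduct.tensorTensorTensorComm K H A H B).toLinearMap
    ∘ₗ (TensorProduct.map (TensorProduct.comm K A H).toLinearMap LinearMap.id)
    ∘ₗ (TensorProduct.map ρ.toLinearMap lam.toLinearMap)

section AntipodeTwist

variable {K A B H : Type} [Field K] [Ring A] [Algebra K A] [Ring B] [Algebra K B]
  [Ring H] [HopfAlgebra K H]

variable (K A B H) in
/-- The linear map `(a ⊗ h) ⊗ (k ⊗ b) ↦ S(h) k ⊗ (a ⊗ b)`. -/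
def antipodeTwist : (A ⊗[K] H) ⊗[K] (H ⊗[K] B) →ₗ[K] H ⊗[K] (A ⊗[K] B) :=
  (TensorProduct.map
      ((LinearMap.mul' K H).comp
        (TensorProduct.map (HopfAlgebra.antipode (R := K)) LinearMap.id))
      LinearMap.id)
    ∘ₗ (TensorProduct.tensorTensorTensorComm K H A H B).toLinearMap
    ∘ₗ (TensorProduct.map (TensorProduct.comm K A H).toLinearMap LinearMap.id)

@[simp]
theorem antipodeTwist_tmul (a : A) (h k : H) (b : B) :
    antipodeTwist K A B H ((a ⊗ₜ h) ⊗ₜ (k ⊗ₜ b)) =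
      (HopfAlgebra.antipode K h * k) ⊗ₜ (a ⊗ₜ b) := by
  simp [antipodeTwist]

theorem gammaMap_eq_antipodeTwist (ρ : A →ₐ[K] A ⊗[K] H) (lam : B →ₐ[K] H ⊗[K] B)
    (v : A ⊗[K] B) :
    gammaMap K A B H ρ lam v = antipodeTwist K A B H (Algebra.TensorProduct.map ρ lam v) :=
  rfl

theorem antipodeTwist_mul_tmul (t : (A ⊗[K] H) ⊗[K] (H ⊗[K] B)) (c : A) (h k : H) (d : B) :
    antipodeTwist K A B H (t * ((c ⊗ₜ h) ⊗ₜ (k ⊗ₜ d))) =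
      (HopfAlgebra.antipode K h ⊗ₜ 1) * antipodeTwist K A B H t * (k ⊗ₜ (c ⊗ₜ d)) := by
  induction t with
  | zero => simp
  | add t t' ht ht' => simp only [add_mul, mul_add, map_add, ht, ht']
  | tmul x p =>
    induction x with
    | zero => simp
    | add x x' hx hx' => simp only [TensorProduct.add_tmul, add_mul, mul_add, map_add, hx, hx']
    | tmul a g =>
      induction p with
      | zero => simp
      | add p p' hp hp' => simp only [TensorProduct.tmul_add, add_mul, mul_add, map_add, hp, hp']
      | tmul l b => simp [HopfAlgebra.antipode_mul_antidistrib, mul_assoc]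

theorem antipodeTwist_mul {t : (A ⊗[K] H) ⊗[K] (H ⊗[K] B)} {z : H} {v : A ⊗[K] B}
    (hz : ∀ h : H, z * h = h * z) (ht : antipodeTwist K A B H t = z ⊗ₜ v)
    (s : (A ⊗[K] H) ⊗[K] (H ⊗[K] B)) :
    antipodeTwist K A B H (t * s) = antipodeTwist K A B H t * antipodeTwist K A B H s := by
  induction s with
  | zero => simp
  | add s s' hs hs' => simp only [mul_add, map_add, hs, hs']
  | tmul x p =>
    induction x with
    | zero => simp
    | add x x' hx hx' => simp only [TensorProduct.add_tmul, mul_add, map_add, hx, hx']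
    | tmul c h =>
      induction p with
      | zero => simp
      | add p p' hp hp' => simp only [TensorProduct.tmul_add, mul_add, map_add, hp, hp']
      | tmul k d =>
        rw [antipodeTwist_mul_tmul, ht, antipodeTwist_tmul, Algebra.TensorProduct.tmul_mul_tmul,
          Algebra.TensorProduct.tmul_mul_tmul, Algebra.TensorProduct.tmul_mul_tmul, one_mul,
          ← hz, mul_assoc]

end AntipodeTwist

/-- if `γ*(v) = z ⊗ v` with `z` central in `H`, then
`γ*(v w) = γ*(v) γ*(w)` for all `w ∈ A ⊗ B`; in particular this holds when `v` is a
`γ*`-coinvariant (the case `z = 1`). -/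
theorem stmt0 (K A B H : Type) [Field K] [Ring A] [Algebra K A] [Ring B] [Algebra K B]
    [Ring H] [HopfAlgebra K H]
    (ρ : A →ₐ[K] A ⊗[K] H) (lam : B →ₐ[K] H ⊗[K] B)
    -- `(A, ρ*)` is a right `H`-comodule (counit and coassociativity axioms):
    (hρcounit : ∀ a : A,
      (TensorProduct.rid K A)
        ((TensorProduct.map LinearMap.id (Coalgebra.counit (R := K) (A := H))) (ρ a)) = a)
    (hρcoassoc : ∀ a : A,
      (TensorProduct.assoc K A H H)
          ((TensorProduct.map ρ.toLinearMap LinearMap.id) (ρ a)) =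
        (TensorProduct.map LinearMap.id (Coalgebra.comul (R := K))) (ρ a))
    -- `(B, λ*)` is a left `H`-comodule:
    (hlamcounit : ∀ b : B,
      (TensorProduct.lid K B)
        ((TensorProduct.map (Coalgebra.counit (R := K) (A := H)) LinearMap.id) (lam b)) = b)
    (hlamcoassoc : ∀ b : B,
      (TensorProduct.map (Coalgebra.comul (R := K)) LinearMap.id) (lam b) =
        (TensorProduct.assoc K H H B).symm
          ((TensorProduct.map LinearMap.id lam.toLinearMap) (lam b)))
    (v : A ⊗[K] B) (z : H) (hz : ∀ h : H, z * h = h * z)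
    (hv : gammaMap K A B H ρ lam v = z ⊗ₜ[K] v) :
    ∀ w : A ⊗[K] B,
      gammaMap K A B H ρ lam (v * w) =
        gammaMap K A B H ρ lam v * gammaMap K A B H ρ lam w := by
  intro w
  simp only [gammaMap_eq_antipodeTwist] at hv ⊢
  rw [map_mul]
  exact antipodeTwist_mul hz hv _

end
end

section
/- Let H be a Hopf algebra over a field K with antipode S, let (A, ρ*) be a right H-comodule algebra and (B, λ*) a left H-comodule algebra, and let γ* : A ⊗ B → H ⊗ A ⊗ B be the left H-comodule structure map given by γ*(a ⊗ b) = Σ S(a_1)b_{−1} ⊗ a_0 ⊗ b_0. Then the product of any two γ*-coinvariants in A ⊗ B is again a γ*-coinvariant, and the set of coinvariants (A ⊗ B)^{co H} := {x ∈ A ⊗ B : γ*(x) = 1 ⊗ x} is a subalgebra of A ⊗ B. -/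
open scoped TensorProduct

noncomputable section

/-- The bilinear action of `A ⊗ H` on `H ⊗ (A ⊗ B)` given by
`(a ⊗ h) • (k ⊗ y) = S(h) k ⊗ y (a ⊗ 1)`. -/
def antipodeAction (K A B H : Type) [Field K] [Ring A] [Algebra K A] [Ring B] [Algebra K B]
    [Ring H] [HopfAlgebra K H] :
    (A ⊗[K] H) →ₗ[K] (H ⊗[K] (A ⊗[K] B)) →ₗ[K] (H ⊗[K] (A ⊗[K] B)) :=
  TensorProduct.lift <| LinearMap.flip <|
    (TensorProduct.mapBilinear (RingHom.id K) H (A ⊗[K] B) H (A ⊗[K] B)).compl₁₂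
      ((LinearMap.mul K H).comp (HopfAlgebra.antipode (R := K)))
      ((LinearMap.mul K (A ⊗[K] B)).flip.comp
        (Algebra.TensorProduct.includeLeft (R := K) (S := K) (A := A) (B := B)).toLinearMap)

/-- The algebra morphism `b ↦ Σ b₋₁ ⊗ 1 ⊗ b₀` from `B` to `H ⊗ (A ⊗ B)`. -/
def rightCoactionHom (K A B H : Type) [Field K] [Ring A] [Algebra K A] [Ring B] [Algebra K B]
    [Ring H] [HopfAlgebra K H] (lam : B →ₐ[K] H ⊗[K] B) : B →ₐ[K] H ⊗[K] (A ⊗[K] B) :=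
  (Algebra.TensorProduct.map (AlgHom.id K H) Algebra.TensorProduct.includeRight).comp lam

section Coinvariants

variable {K A B H : Type} [Field K] [Ring A] [Algebra K A] [Ring B] [Algebra K B]
  [Ring H] [HopfAlgebra K H]

lemma antipodeAction_tmul (a : A) (h k : H) (y : A ⊗[K] B) :
    antipodeAction K A B H (a ⊗ₜ h) (k ⊗ₜ y) =
      (HopfAlgebra.antipode K h * k) ⊗ₜ (y * (a ⊗ₜ 1)) := by
  simp [antipodeAction]

lemma antipodeAction_mul (u v : A ⊗[K] H) (x : H ⊗[K] (A ⊗[K] B)) :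
    antipodeAction K A B H (u * v) x =
      antipodeAction K A B H v (antipodeAction K A B H u x) := by
  induction u with
  | zero => simp
  | add u₁ u₂ h₁ h₂ => simp only [add_mul, map_add, LinearMap.add_apply, h₁, h₂]
  | tmul a h =>
    induction v with
    | zero => simp
    | add v₁ v₂ h₁ h₂ => simp only [mul_add, map_add, LinearMap.add_apply, h₁, h₂]
    | tmul c k =>
      induction x with
      | zero => simp
      | add x₁ x₂ h₁ h₂ => simp only [map_add, h₁, h₂]
      | tmul l y =>
        simp only [Algebra.TensorProduct.tmul_mul_tmul, antipodeAction_tmul,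
          HopfAlgebra.antipode_mul_antidistrib, mul_assoc, mul_one]

lemma antipodeAction_mul_map_includeRight (u : A ⊗[K] H) (x : H ⊗[K] (A ⊗[K] B))
    (z : H ⊗[K] B) :
    antipodeAction K A B H u (x * Algebra.TensorProduct.map (AlgHom.id K H)
        (Algebra.TensorProduct.includeRight (R := K) (A := A)) z) =
      antipodeAction K A B H u x * Algebra.TensorProduct.map (AlgHom.id K H)
        (Algebra.TensorProduct.includeRight (R := K) (A := A)) z := by
  induction u with
  | zero => simp
  | add u₁ u₂ h₁ h₂ => simp only [add_mul, map_add, LinearMap.add_apply, h₁, h₂]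
  | tmul a h =>
    induction z with
    | zero => simp
    | add z₁ z₂ h₁ h₂ => simp only [mul_add, map_add, h₁, h₂]
    | tmul k b =>
      induction x with
      | zero => simp
      | add x₁ x₂ h₁ h₂ => simp only [add_mul, map_add, h₁, h₂]
      | tmul l y =>
        simp only [Algebra.TensorProduct.map_tmul, Algebra.TensorProduct.tmul_mul_tmul,
          antipodeAction_tmul, AlgHom.id_apply, Algebra.TensorProduct.includeRight_apply,
          mul_assoc, mul_one, one_mul]

lemma antipodeAction_one_tmul_mul (u : A ⊗[K] H) (y : A ⊗[K] B) (x : H ⊗[K] (A ⊗[K] B)) :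
    antipodeAction K A B H u ((1 ⊗ₜ y) * x) = (1 ⊗ₜ y) * antipodeAction K A B H u x := by
  induction u with
  | zero => simp
  | add u₁ u₂ h₁ h₂ => simp only [mul_add, map_add, LinearMap.add_apply, h₁, h₂]
  | tmul a h =>
    induction x with
    | zero => simp
    | add x₁ x₂ h₁ h₂ => simp only [mul_add, map_add, h₁, h₂]
    | tmul l z =>
      simp only [Algebra.TensorProduct.tmul_mul_tmul, antipodeAction_tmul, one_mul, mul_assoc]

lemma gammaMap_tmul (ρ : A →ₐ[K] A ⊗[K] H) (lam : B →ₐ[K] H ⊗[K] B) (a : A) (b : B) :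
    gammaMap K A B H ρ lam (a ⊗ₜ b) =
      antipodeAction K A B H (ρ a) (rightCoactionHom K A B H lam b) := by
  simp only [gammaMap, rightCoactionHom, LinearMap.comp_apply, TensorProduct.map_tmul,
    AlgHom.toLinearMap_apply, AlgHom.comp_apply]
  generalize ρ a = u
  generalize lam b = z
  induction u with
  | zero => simp
  | add u₁ u₂ h₁ h₂ => simp only [TensorProduct.add_tmul, map_add, LinearMap.add_apply, h₁, h₂]
  | tmul a h =>
    induction z with
    | zero => simp
    | add z₁ z₂ h₁ h₂ => simp only [TensorProduct.tmul_add, map_add, h₁, h₂]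
    | tmul k b => simp [antipodeAction_tmul]

lemma gammaMap_one (ρ : A →ₐ[K] A ⊗[K] H) (lam : B →ₐ[K] H ⊗[K] B) :
    gammaMap K A B H ρ lam 1 = 1 ⊗ₜ 1 := by
  rw [Algebra.TensorProduct.one_def, gammaMap_tmul, map_one ρ,
    map_one (rightCoactionHom K A B H lam),
    Algebra.TensorProduct.one_def, Algebra.TensorProduct.one_def, antipodeAction_tmul]
  simp [Algebra.TensorProduct.one_def]

lemma gammaMap_mul_tmul (ρ : A →ₐ[K] A ⊗[K] H) (lam : B →ₐ[K] H ⊗[K] B) (v : A ⊗[K] B)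
    (c : A) (d : B) :
    gammaMap K A B H ρ lam (v * (c ⊗ₜ d)) =
      antipodeAction K A B H (ρ c)
        (gammaMap K A B H ρ lam v * rightCoactionHom K A B H lam d) := by
  induction v with
  | zero => simp
  | add v₁ v₂ h₁ h₂ => simp only [add_mul, map_add, h₁, h₂]
  | tmul a b =>
    rw [Algebra.TensorProduct.tmul_mul_tmul, gammaMap_tmul, gammaMap_tmul, map_mul ρ,
      map_mul (rightCoactionHom K A B H lam),
      antipodeAction_mul]
    congr 1
    exact antipodeAction_mul_map_includeRight _ _ _

/-- If `v` is coinvariant, then `γ*` commutes with left multiplication by `v`. -/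
lemma gammaMap_mul_of_coinvariant (ρ : A →ₐ[K] A ⊗[K] H) (lam : B →ₐ[K] H ⊗[K] B)
    {v : A ⊗[K] B} (hv : gammaMap K A B H ρ lam v = 1 ⊗ₜ v) (w : A ⊗[K] B) :
    gammaMap K A B H ρ lam (v * w) = (1 ⊗ₜ v) * gammaMap K A B H ρ lam w := by
  induction w with
  | zero => simp
  | add w₁ w₂ h₁ h₂ => simp only [mul_add, map_add, h₁, h₂]
  | tmul c d =>
    rw [gammaMap_mul_tmul, hv, antipodeAction_one_tmul_mul, gammaMap_tmul]

end Coinvariants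

/-- the product of two `γ*`-coinvariants is a `γ*`-coinvariant, and the set of
coinvariants `(A ⊗ B)^{co H} = {x | γ*(x) = 1 ⊗ x}` is a subalgebra of `A ⊗ B`. -/
theorem stmt1 (K A B H : Type) [Field K] [Ring A] [Algebra K A] [Ring B] [Algebra K B]
    [Ring H] [HopfAlgebra K H]
    (ρ : A →ₐ[K] A ⊗[K] H) (lam : B →ₐ[K] H ⊗[K] B)
    (hρcounit : ∀ a : A,
      (TensorProduct.rid K A)
        ((TensorProduct.map LinearMap.id (Coalgebra.counit (R := K) (A := H))) (ρ a)) = a)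
    (hρcoassoc : ∀ a : A,
      (TensorProduct.assoc K A H H)
          ((TensorProduct.map ρ.toLinearMap LinearMap.id) (ρ a)) =
        (TensorProduct.map LinearMap.id (Coalgebra.comul (R := K))) (ρ a))
    (hlamcounit : ∀ b : B,
      (TensorProduct.lid K B)
        ((TensorProduct.map (Coalgebra.counit (R := K) (A := H)) LinearMap.id) (lam b)) = b)
    (hlamcoassoc : ∀ b : B,
      (TensorProduct.map (Coalgebra.comul (R := K)) LinearMap.id) (lam b) =
        (TensorProduct.assoc K H H B).symm
          ((TensorProduct.map LinearMap.id lam.toLinearMap) (lam b))) :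
    (∀ v w : A ⊗[K] B,
        gammaMap K A B H ρ lam v = (1 : H) ⊗ₜ[K] v →
        gammaMap K A B H ρ lam w = (1 : H) ⊗ₜ[K] w →
        gammaMap K A B H ρ lam (v * w) = (1 : H) ⊗ₜ[K] (v * w)) ∧
    (∃ S : Subalgebra K (A ⊗[K] B),
        (S : Set (A ⊗[K] B)) =
          {x : A ⊗[K] B | gammaMap K A B H ρ lam x = (1 : H) ⊗ₜ[K] x}) := by
  have hmul : ∀ v w : A ⊗[K] B,
      gammaMap K A B H ρ lam v = (1 : H) ⊗ₜ[K] v →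
      gammaMap K A B H ρ lam w = (1 : H) ⊗ₜ[K] w →
      gammaMap K A B H ρ lam (v * w) = (1 : H) ⊗ₜ[K] (v * w) := fun v w hv hw => by
    rw [gammaMap_mul_of_coinvariant ρ lam hv, hw, Algebra.TensorProduct.tmul_mul_tmul, one_mul]
  let M : Submodule K (A ⊗[K] B) :=
    LinearMap.eqLocus (gammaMap K A B H ρ lam) (TensorProduct.mk K H (A ⊗[K] B) 1)
  exact ⟨hmul, M.toSubalgebra (gammaMap_one ρ lam) hmul, rfl⟩

end
end

section
/- Let K be a field, q ∈ K nonzero, and m, n, t positive integers. The kernel of the algebra morphism θ*_q : O_q(M_{m,n}) → O_q(M_{m,t}) ⊗ O_q(M_{t,n}), X_{ij} ↦ Σ_{k=1}^t Y_{ik} ⊗ Z_{kj}, equals the ideal I_{t+1} generated by all (t+1)×(t+1) quantum minors; equivalently, the induced morphism μ*_q : O_q(M_{m,n}^{≤t}) → O_q(M_{m,t}) ⊗ O_q(M_{t,n}) is injective. In particular, O_q(M_{m,n}^{≤t}) = O_q(M_{m,n})/I_{t+1} is an integral domain. -/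
open scoped TensorProduct

noncomputable section

/-- The four defining relations of the quantized coordinate ring `O_q(M_{u,v})`, as a relation
on the free algebra on generators `X_{ij}`, `(i,j) ∈ Fin u × Fin v`. -/
inductive QMRel (K : Type) [Field K] (q : K) (u v : ℕ) :
    FreeAlgebra K (Fin u × Fin v) → FreeAlgebra K (Fin u × Fin v) → Prop
  | row {i : Fin u} {j k : Fin v} (h : j < k) :
      QMRel K q u v (FreeAlgebra.ι K (i, j) * FreeAlgebra.ι K (i, k))
        (q • (FreeAlgebra.ι K (i, k) * FreeAlgebra.ι K (i, j)))
  | col {i k : Fin u} {j : Fin v} (h : i < k) :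
      QMRel K q u v (FreeAlgebra.ι K (i, j) * FreeAlgebra.ι K (k, j))
        (q • (FreeAlgebra.ι K (k, j) * FreeAlgebra.ι K (i, j)))
  | comm {i k : Fin u} {j l : Fin v} (h1 : i < k) (h2 : l < j) :
      QMRel K q u v (FreeAlgebra.ι K (i, j) * FreeAlgebra.ι K (k, l))
        (FreeAlgebra.ι K (k, l) * FreeAlgebra.ι K (i, j))
  | quantum {i k : Fin u} {j l : Fin v} (h1 : i < k) (h2 : j < l) :
      QMRel K q u v (FreeAlgebra.ι K (i, j) * FreeAlgebra.ι K (k, l))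
        (FreeAlgebra.ι K (k, l) * FreeAlgebra.ι K (i, j) +
          (q - q⁻¹) • (FreeAlgebra.ι K (i, l) * FreeAlgebra.ι K (k, j)))

/-- The quantized coordinate ring `O_q(M_{u,v})` of `u × v` matrices. -/
abbrev OqM (K : Type) [Field K] (q : K) (u v : ℕ) :=
  RingQuot (QMRel K q u v)

/-- The canonical generators `X_{ij}` of `O_q(M_{u,v})`. -/
def Xg (K : Type) [Field K] (q : K) {u v : ℕ} (i : Fin u) (j : Fin v) : OqM K q u v :=
  RingQuot.mkAlgHom K (QMRel K q u v) (FreeAlgebra.ι K (i, j))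

/-- The number of inversions (the length) of a permutation of `Fin l`. -/
def invCount {l : ℕ} (σ : Equiv.Perm (Fin l)) : ℕ :=
  (Finset.univ.filter fun p : Fin l × Fin l => p.1 < p.2 ∧ σ p.2 < σ p.1).card

/-- The `l × l` quantum minor of `O_q(M_{u,v})` with rows `R 0, …, R (l-1)` and columns
`C 0, …, C (l-1)`:  `[R|C] = Σ_σ (-q)^{ℓ(σ)} X_{R 0, C (σ 0)} ⋯ X_{R (l-1), C (σ (l-1))}`. -/
def qMinor (K : Type) [Field K] (q : K) {u v l : ℕ} (R : Fin l → Fin u) (C : Fin l → Fin v) :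
    OqM K q u v :=
  ∑ σ : Equiv.Perm (Fin l),
    ((-q) ^ invCount σ) • (List.ofFn fun i : Fin l => Xg K q (R i) (C (σ i))).prod

/-- The relations killing all `(t+1) × (t+1)` quantum minors of `O_q(M_{m,n})`. -/
inductive DetRel (K : Type) [Field K] (q : K) (m n t : ℕ) :
    OqM K q m n → OqM K q m n → Prop
  | minor (R : Fin (t + 1) → Fin m) (C : Fin (t + 1) → Fin n)
      (hR : StrictMono R) (hC : StrictMono C) :
      DetRel K q m n t (qMinor K q R C) 0

/-- `O_q(M_{m,n}^{≤ t}) = O_q(M_{m,n}) / I_{t+1}`, the quotient by the ideal generated by all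
`(t+1) × (t+1)` quantum minors. -/
abbrev OqMle (K : Type) [Field K] (q : K) (m n t : ℕ) :=
  RingQuot (DetRel K q m n t)

/-- The quotient map `O_q(M_{m,n}) → O_q(M_{m,n}^{≤ t})`. -/
def mkle (K : Type) [Field K] (q : K) (m n t : ℕ) :
    OqM K q m n →ₐ[K] OqMle K q m n t :=
  RingQuot.mkAlgHom K (DetRel K q m n t)

/-- The two-sided ideal of a `K`-algebra `R` generated by a subset `S`, as a set. -/
def tsSpan (K : Type) [Field K] (R : Type) [Ring R] [Algebra K R] (S : Set R) : Set R :=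
  (Submodule.span K {x : R | ∃ a b : R, ∃ s ∈ S, x = a * s * b} : Submodule K R)

/-- The set of all `(t+1) × (t+1)` quantum minors of `O_q(M_{m,n})`. -/
def minorSet (K : Type) [Field K] (q : K) (m n t : ℕ) : Set (OqM K q m n) :=
  {y | ∃ (R : Fin (t + 1) → Fin m) (C : Fin (t + 1) → Fin n),
    StrictMono R ∧ StrictMono C ∧ y = qMinor K q R C}

/-- The monomial operator `E_g` on `K[G]`: it sends the basis vector `h` to
`q ^ B(g, h)` times the basis vector `g + h`. -/
def monOp {K : Type} [Field K] (q : K) {G : Type} [AddCommGroup G] (B : G →+ G →+ ℤ) (g : G) :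
    Module.End K (G →₀ K) :=
  Finsupp.linearCombination K fun h => Finsupp.single (g + h) (q ^ B g h)

/-- The span of the monomial operators of weight at most `w`. -/
def wtSpan {K : Type} [Field K] (q : K) {G : Type} [AddCommGroup G] (B : G →+ G →+ ℤ)
    (wt : G →+ ℤ) (w : ℤ) : Submodule K (Module.End K (G →₀ K)) :=
  Submodule.span K (monOp q B '' {g | wt g ≤ w})

/-- `x` is a nonzero multiple of `E_g` up to operators of smaller weight. -/
def HasLead {K : Type} [Field K] (q : K) {G : Type} [AddCommGroup G] (B : G →+ G →+ ℤ)
    (wt : G →+ ℤ) (x : Module.End K (G →₀ K)) (g : G) : Prop :=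
  ∃ c : K, c ≠ 0 ∧ ∃ r ∈ wtSpan q B wt (wt g - 1), x = c • monOp q B g + r

section Torus

variable {K : Type} [Field K] {q : K} {G : Type} [AddCommGroup G] {B : G →+ G →+ ℤ}
  {wt : G →+ ℤ}

theorem monOp_single (g h : G) (c : K) :
    monOp q B g (Finsupp.single h c) = Finsupp.single (g + h) (c * q ^ B g h) := by
  simp [monOp]

theorem monOp_zero : monOp q B 0 = 1 := by
  ext h : 2
  simp [monOp_single]

theorem monOp_mul (hq : q ≠ 0) (g h : G) :
    monOp q B g * monOp q B h = q ^ B g h • monOp q B (g + h) := by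
  ext k : 2
  simp only [LinearMap.comp_apply, Finsupp.lsingle_apply, Module.End.mul_apply, monOp_single,
    LinearMap.smul_apply, Finsupp.smul_single, smul_eq_mul, map_add, AddMonoidHom.add_apply,
    one_mul, zpow_add₀ hq]
  rw [add_assoc]
  congr 1
  ring

theorem monOp_mem_wtSpan {g : G} {w : ℤ} (h : wt g ≤ w) : monOp q B g ∈ wtSpan q B wt w :=
  Submodule.subset_span ⟨g, h, rfl⟩

theorem wtSpan_mono {w w' : ℤ} (h : w ≤ w') : wtSpan q B wt w ≤ wtSpan q B wt w' :=
  Submodule.span_mono (Set.image_mono fun _ hg => le_trans hg h)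

theorem wtSpan_mul (hq : q ≠ 0) {w w' : ℤ} {x y : Module.End K (G →₀ K)}
    (hx : x ∈ wtSpan q B wt w) (hy : y ∈ wtSpan q B wt w') :
    x * y ∈ wtSpan q B wt (w + w') := by
  have := Submodule.mul_mem_mul hx hy
  rw [wtSpan, wtSpan, Submodule.span_mul_span] at this
  refine Submodule.span_le.2 ?_ this
  rintro _ ⟨_, ⟨g, hg, rfl⟩, _, ⟨h, hh, rfl⟩, rfl⟩
  simp only [Set.mem_ofPred_eq] at hg hh
  simp only [monOp_mul hq]
  exact Submodule.smul_mem _ _ (monOp_mem_wtSpan (by rw [map_add]; omega))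

theorem one_mem_wtSpan : (1 : Module.End K (G →₀ K)) ∈ wtSpan q B wt 0 := by
  rw [← monOp_zero (q := q) (B := B)]
  exact monOp_mem_wtSpan (by simp)

theorem hasLead_monOp (g : G) : HasLead q B wt (monOp q B g) g :=
  ⟨1, one_ne_zero, 0, Submodule.zero_mem _, by simp⟩

theorem hasLead_one : HasLead q B wt (1 : Module.End K (G →₀ K)) 0 := by
  rw [← monOp_zero (q := q) (B := B)]
  exact hasLead_monOp 0

theorem HasLead.mem {x : Module.End K (G →₀ K)} {g : G} (h : HasLead q B wt x g) :
    x ∈ wtSpan q B wt (wt g) := by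
  obtain ⟨c, -, r, hr, rfl⟩ := h
  exact Submodule.add_mem _ (Submodule.smul_mem _ c (monOp_mem_wtSpan le_rfl))
    (wtSpan_mono (by omega) hr)

theorem HasLead.add_lower {x y : Module.End K (G →₀ K)} {g : G} (h : HasLead q B wt x g)
    (hy : y ∈ wtSpan q B wt (wt g - 1)) : HasLead q B wt (x + y) g := by
  obtain ⟨c, hc, r, hr, rfl⟩ := h
  exact ⟨c, hc, r + y, Submodule.add_mem _ hr hy, add_assoc _ _ _⟩

theorem HasLead.mul (hq : q ≠ 0) {x y : Module.End K (G →₀ K)} {g h : G}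
    (hx : HasLead q B wt x g) (hy : HasLead q B wt y h) : HasLead q B wt (x * y) (g + h) := by
  have hy' := hy.mem
  obtain ⟨c, hc, r, hr, rfl⟩ := hx
  obtain ⟨d, hd, r', hr', rfl⟩ := hy
  have h1 := wtSpan_mul hq hr hy'
  have h2 := wtSpan_mul hq
    (Submodule.smul_mem _ c (monOp_mem_wtSpan (q := q) (B := B) (le_refl (wt g)))) hr'
  refine ⟨c * d * q ^ B g h, mul_ne_zero (mul_ne_zero hc hd) (zpow_ne_zero _ hq), _,
    Submodule.add_mem _ (wtSpan_mono (w' := wt (g + h) - 1) (by rw [map_add]; omega) h2)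
    (wtSpan_mono (w' := wt (g + h) - 1) (by rw [map_add]; omega) h1), ?_⟩
  rw [add_mul, mul_add, add_assoc, smul_mul_smul_comm, monOp_mul hq, smul_smul]

theorem hasLead_list_prod (hq : q ≠ 0) {l : List ℕ} {x : ℕ → Module.End K (G →₀ K)} {g : ℕ → G}
    (h : ∀ i ∈ l, HasLead q B wt (x i) (g i)) :
    HasLead q B wt (l.map x).prod (l.map g).sum := by
  induction l with
  | nil => simpa using hasLead_one
  | cons a l ih =>
    simp only [List.map_cons, List.prod_cons, List.sum_cons]
    exact (h a (by simp)).mul hq (ih fun i hi => h i (by simp [hi]))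

theorem hasLead_ofFn_prod (hq : q ≠ 0) {n : ℕ} {x : Fin n → Module.End K (G →₀ K)}
    {g : Fin n → G} (h : ∀ i, HasLead q B wt (x i) (g i)) :
    HasLead q B wt (List.ofFn x).prod (∑ i, g i) := by
  induction n with
  | zero => simpa using hasLead_one
  | succ n ih =>
    rw [List.ofFn_succ, List.prod_cons, Fin.sum_univ_succ]
    exact (h 0).mul hq (ih fun i => h i.succ)

theorem ofFn_prod_mem_wtSpan (hq : q ≠ 0) {n : ℕ} {x : Fin n → Module.End K (G →₀ K)}
    {w : Fin n → ℤ} (h : ∀ i, x i ∈ wtSpan q B wt (w i)) :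
    (List.ofFn x).prod ∈ wtSpan q B wt (∑ i, w i) := by
  induction n with
  | zero => simpa using one_mem_wtSpan
  | succ n ih =>
    rw [List.ofFn_succ, List.prod_cons, Fin.sum_univ_succ]
    exact wtSpan_mul hq (h 0) (ih fun i => h i.succ)

theorem wtSpan_apply_eq_zero {w : ℤ} {x : Module.End K (G →₀ K)} (hx : x ∈ wtSpan q B wt w)
    {g : G} (hg : w < wt g) : x (Finsupp.single 0 1) g = 0 := by
  induction hx using Submodule.span_induction with
  | mem x hx =>
    obtain ⟨h, hh, rfl⟩ := hx
    have : h ≠ g := by rintro rfl; exact absurd hg (not_lt.2 hh)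
    simp [monOp_single, this]
  | zero => simp
  | add x y _ _ hx hy => simp [hx, hy]
  | smul c x _ hx => simp [hx]

theorem linearIndependent_of_hasLead {ι : Type} {x : ι → Module.End K (G →₀ K)} {g : ι → G}
    (hg : Function.Injective g) (h : ∀ i, HasLead q B wt (x i) (g i)) :
    LinearIndependent K fun i => x i (Finsupp.single 0 1) := by
  classical
  rw [linearIndependent_iff']
  intro s a hs
  by_contra! hne
  obtain ⟨i, hi, hai⟩ := hne
  obtain ⟨j, hj, hmax⟩ := Finset.exists_max_image (s.filter fun i => a i ≠ 0)
    (fun i => wt (g i)) ⟨i, by simp [hi, hai]⟩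
  rw [Finset.mem_filter] at hj
  have key : (∑ i ∈ s, a i • x i (Finsupp.single 0 1)) (g j) =
      a j * (x j (Finsupp.single 0 1) (g j)) := by
    rw [Finsupp.finsetSum_apply, Finset.sum_eq_single_of_mem j hj.1]
    · simp
    · intro k hk hkj
      by_cases hak : a k = 0
      · simp [hak]
      obtain ⟨c, hc, r, hr, hx⟩ := h k
      have hle := hmax k (by simp [hk, hak])
      have h0 := wtSpan_apply_eq_zero hr (g := g j) (by omega)
      have hgk : g k ≠ g j := fun h => hkj (hg h)
      have : x k (Finsupp.single 0 1) (g j) = 0 := by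
        simp [hx, monOp_single, hgk, h0]
      simp [this]
  rw [hs] at key
  obtain ⟨c, hc, r, hr, hx⟩ := h j
  have h0 := wtSpan_apply_eq_zero hr (g := g j) (by omega)
  have : x j (Finsupp.single 0 1) (g j) = c := by
    simp [hx, monOp_single, h0]
  rw [this] at key
  exact mul_ne_zero hj.2 hc (by simpa using key.symm)

theorem eq_linearCombination_monOp {x : Module.End K (G →₀ K)}
    (hx : x ∈ Submodule.span K (Set.range (monOp q B))) :
    x = Finsupp.linearCombination K (monOp q B) (x (Finsupp.single 0 1)) := by
  induction hx using Submodule.span_induction with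
  | mem x hx => obtain ⟨h, rfl⟩ := hx; simp [monOp_single]
  | zero => simp
  | add x y _ _ hx hy =>
    rw [LinearMap.add_apply, map_add, ← hx, ← hy]
  | smul c x _ hx => rw [LinearMap.smul_apply, map_smul, ← hx]

theorem mul_ne_zero_of_mem_span_monOp [UniqueSums G] (hq : q ≠ 0) {x y : Module.End K (G →₀ K)}
    (hx : x ∈ Submodule.span K (Set.range (monOp q B)))
    (hy : y ∈ Submodule.span K (Set.range (monOp q B))) (hx0 : x ≠ 0) (hy0 : y ≠ 0) :
    x * y ≠ 0 := by
  classical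
  set u := x (Finsupp.single 0 1) with hu
  set v := y (Finsupp.single 0 1) with hv
  have ex := eq_linearCombination_monOp hx
  have ey := eq_linearCombination_monOp hy
  rw [← hu] at ex
  rw [← hv] at ey
  have hu0 : u ≠ 0 := by intro h; rw [h, map_zero] at ex; exact hx0 ex
  have hv0 : v ≠ 0 := by intro h; rw [h, map_zero] at ey; exact hy0 ey
  obtain ⟨g, hg, h, hh, huniq⟩ := UniqueSums.uniqueAdd_of_nonempty
    (Finsupp.support_nonempty_iff.2 hu0) (Finsupp.support_nonempty_iff.2 hv0)
  intro hxy
  have h1 : x v (g + h) = 0 := by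
    rw [hv, ← Module.End.mul_apply, hxy]; simp
  have h2 : x v (g + h) = u g * (v h * q ^ B g h) := by
    conv_lhs => rw [ex, ← Finsupp.sum_single v, Finsupp.linearCombination_apply, Finsupp.sum,
      Finsupp.sum]
    simp only [map_sum, LinearMap.sum_apply, LinearMap.smul_apply, monOp_single,
      Finsupp.finsetSum_apply, Finsupp.smul_apply, Finsupp.single_apply, smul_eq_mul]
    rw [Finset.sum_eq_single_of_mem h hh, Finset.sum_eq_single_of_mem g hg]
    · simp
    · intro g' hg' hne
      simp [hne]
    · intro h' hh' hne
      refine Finset.sum_eq_zero fun g' hg' => ?_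
      rw [if_neg, mul_zero]
      intro he
      exact hne (huniq hg' hh' he).2
  rw [h1] at h2
  exact mul_ne_zero (Finsupp.mem_support_iff.1 hg)
    (mul_ne_zero (Finsupp.mem_support_iff.1 hh) (zpow_ne_zero _ hq)) h2.symm

end Torus

/-- The matrix `y` over a `K`-algebra satisfies the relations of the quantized coordinate ring
of matrices. -/
structure IsQMat {K : Type} [Field K] (q : K) {W : Type} [Semiring W] [Algebra K W]
    {ι κ : Type} [LinearOrder ι] [LinearOrder κ] (y : ι → κ → W) : Prop where
  row : ∀ {i j k}, j < k → y i j * y i k = q • (y i k * y i j)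
  col : ∀ {i k j}, i < k → y i j * y k j = q • (y k j * y i j)
  comm : ∀ {i k j l}, i < k → l < j → y i j * y k l = y k l * y i j
  quantum : ∀ {i k j l}, i < k → j < l →
    y i j * y k l = y k l * y i j + (q - q⁻¹) • (y i l * y k j)

section QMat

variable {K : Type} [Field K] {q : K} {W : Type} [Semiring W] [Algebra K W]
  {ι κ ν : Type} [LinearOrder ι] [LinearOrder κ] [LinearOrder ν]

theorem IsQMat.transpose {y : ι → κ → W} (h : IsQMat q y) : IsQMat q fun i j => y j i where
  row h1 := h.col h1
  col h1 := h.row h1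
  comm h1 h2 := (h.comm h2 h1).symm
  quantum h1 h2 := by rw [h.quantum h2 h1, h.comm h2 h1]

/-- The `R`-matrix form of the relations of quantum matrices. -/
theorem isQMat_iff_rMatrix (hq : q ≠ 0) {y : ι → κ → W} :
    IsQMat q y ↔ ∀ i j k l,
      (if i = j then q else 1) • (y i k * y j l) +
        (if j < i then q - q⁻¹ else 0) • (y j k * y i l) =
      (if k = l then q else 1) • (y j l * y i k) +
        (if k < l then q - q⁻¹ else 0) • (y j k * y i l) := by
  constructor
  · intro h i j k l
    rcases lt_trichotomy i j with hij | rfl | hij <;> rcases lt_trichotomy k l with hkl | rfl | hkl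
    · simp [hij.ne, hij.not_gt, hkl, hkl.ne, h.quantum hij hkl, h.comm hij hkl]
    · simp [hij.ne, hij.not_gt, h.col hij]
    · simp [hij.ne, hij.not_gt, hkl.not_gt, hkl.ne', h.comm hij hkl]
    · simp only [hkl, hkl.ne, if_true, if_false, lt_irrefl, h.row hkl]
      match_scalars
      field_simp
      ring
    · simp
    · simp [hkl.ne', hkl.not_gt, h.row hkl]
    · simp [hij, hij.ne', hkl, hkl.ne, h.comm hij hkl]
    · simp only [hij, hij.ne', if_true, if_false, lt_irrefl, h.col hij]
      match_scalars
      field_simp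
      ring
    · simp [hij, hij.ne', hkl.not_gt, hkl.ne', h.quantum hij hkl, h.comm hij hkl]
  · intro h
    have hcomm : ∀ {i k : ι} {j l : κ}, i < k → l < j → y i j * y k l = y k l * y i j := by
      intro i k j l h1 h2
      simpa [h1.ne, h1.not_gt, h2.not_gt, h2.ne'] using h i k j l
    refine ⟨?_, ?_, hcomm, ?_⟩
    · intro i j k h1
      simpa [h1.ne', h1.not_gt] using (h i i k j).symm
    · intro i k j h1
      simpa [h1.ne, h1.not_gt] using h i k j j
    · intro i k j l h1 h2
      rw [hcomm h1 h2]
      simpa [h1.ne, h1.not_gt, h2, h2.ne] using h i k j l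

theorem IsQMat.mul [Fintype κ] (hq : q ≠ 0) {a : ι → κ → W} {b : κ → ν → W}
    (ha : IsQMat q a) (hb : IsQMat q b) (hab : ∀ i p r k, b p k * a i r = a i r * b p k) :
    IsQMat q fun i k => ∑ p, a i p * b p k := by
  rw [isQMat_iff_rMatrix hq] at ha hb ⊢
  intro i j k l
  have e : ∀ i j k l, (∑ p, a i p * b p k) * (∑ r, a j r * b r l) =
      ∑ p, ∑ r, (a i p * a j r) * (b p k * b r l) := by
    intro i j k l
    rw [Finset.sum_mul_sum]
    refine Finset.sum_congr rfl fun p _ => Finset.sum_congr rfl fun r _ => ?_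
    rw [mul_assoc, ← mul_assoc (b p k), hab, mul_assoc, mul_assoc]
  have e' : ∀ i j k l, (∑ p, a i p * b p k) * (∑ r, a j r * b r l) =
      ∑ p, ∑ r, (a i r * a j p) * (b r k * b p l) := fun i j k l => by
    rw [e, Finset.sum_comm]
  calc _ = ∑ p, ∑ r, ((if i = j then q else 1) • (a i p * a j r) +
        (if j < i then q - q⁻¹ else 0) • (a j p * a i r)) * (b p k * b r l) := by
        simp only [e, Finset.smul_sum, add_mul, Finset.sum_add_distrib, smul_mul_assoc]
    _ = ∑ p, ∑ r, (a j r * a i p) * ((if p = r then q else 1) • (b p k * b r l)) +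
        ∑ p, ∑ r, (a j p * a i r) * ((if p < r then q - q⁻¹ else 0) • (b p k * b r l)) := by
        simp only [ha i j, add_mul, Finset.sum_add_distrib, smul_mul_assoc, mul_smul_comm]
    _ = ∑ p, ∑ r, (a j r * a i p) * ((if p = r then q else 1) • (b p k * b r l)) +
        ∑ p, ∑ r, (a j r * a i p) * ((if r < p then q - q⁻¹ else 0) • (b r k * b p l)) := by
        congr 1
        exact Finset.sum_comm
    _ = ∑ p, ∑ r, (a j r * a i p) * ((if k = l then q else 1) • (b r l * b p k) +
          (if k < l then q - q⁻¹ else 0) • (b r k * b p l)) := by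
        simp only [← hb, mul_add, Finset.sum_add_distrib]
    _ = _ := by
        rw [e' j i l k, e' j i k l]
        simp only [mul_add, Finset.sum_add_distrib, Finset.smul_sum, mul_smul_comm]

end QMat

/-- The indices of the variables of the quantum torus: a side, a type (`true` for off-diagonal
entries), the number of a bidiagonal factor, and the number of a row. -/
abbrev TVar := Bool × Bool × ℕ × ℕ

/-- The values of the commutation form on the variables. -/
def tPair (u v : TVar) : ℤ :=
  if u.1 = v.1 ∧ u.2.2.1 = v.2.2.1 ∧ u.2.1 = true ∧ v.2.1 = false then
    (if v.2.2.2 = u.2.2.2 then 1 else 0) - (if v.2.2.2 + 1 = u.2.2.2 then 1 else 0)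
  else 0

/-- The commutation form of the quantum torus. -/
def tForm : (TVar →₀ ℤ) →+ (TVar →₀ ℤ) →+ ℤ :=
  Finsupp.liftAddHom fun u => zmultiplesHom _
    (Finsupp.liftAddHom fun v => zmultiplesHom ℤ (tPair u v))

/-- The weight of a monomial of the quantum torus. -/
def tWt (M : ℤ) : (TVar →₀ ℤ) →+ ℤ :=
  Finsupp.liftAddHom fun u => zmultiplesHom ℤ
    (if u.2.1 = true then M + u.2.2.1 - u.2.2.2 else 0)

/-- The variables of the quantum torus. -/
def tVar {K : Type} [Field K] (q : K) (u : TVar) : Module.End K ((TVar →₀ ℤ) →₀ K) :=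
  monOp q tForm (Finsupp.single u 1)

/-- The entries of the product of `r` lower bidiagonal quantum matrices. -/
def lowMat {K : Type} [Field K] (q : K) (sd : Bool) :
    ℕ → ℕ → ℕ → Module.End K ((TVar →₀ ℤ) →₀ K)
  | 0, i, k => if i = k then 1 else 0
  | r + 1, 0, k => tVar q (sd, false, r, 0) * lowMat q sd r 0 k
  | r + 1, i + 1, k => tVar q (sd, false, r, i + 1) * lowMat q sd r (i + 1) k +
      tVar q (sd, true, r, i + 1) * lowMat q sd r i k

/-- The exponents of the leading monomials of `lowMat`. -/
def lowLead (sd : Bool) : ℕ → ℕ → ℕ → (TVar →₀ ℤ)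
  | 0, _, _ => 0
  | r + 1, i, k =>
    if k < i then Finsupp.single (sd, true, r, i) 1 + lowLead sd r (i - 1) k
    else Finsupp.single (sd, false, r, k) 1 + lowLead sd r i k

section LowMat

variable {K : Type} [Field K] {q : K}

theorem tForm_single (u v : TVar) :
    tForm (Finsupp.single u 1) (Finsupp.single v 1) = tPair u v := by
  simp [tForm]

theorem tWt_single (M : ℤ) (u : TVar) :
    tWt M (Finsupp.single u 1) = if u.2.1 = true then M + u.2.2.1 - u.2.2.2 else 0 := by
  simp [tWt]

theorem tVar_mul_tVar (hq : q ≠ 0) (u v : TVar) :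
    tVar q u * tVar q v = q ^ (tPair u v - tPair v u) • (tVar q v * tVar q u) := by
  rw [tVar, tVar, monOp_mul hq, monOp_mul hq, tForm_single, tForm_single, smul_smul,
    ← zpow_add₀ hq, sub_add_cancel, add_comm]

theorem tVar_commute (hq : q ≠ 0) {u v : TVar} (h : tPair u v = tPair v u) :
    Commute (tVar q u) (tVar q v) := by
  rw [Commute, SemiconjBy, tVar_mul_tVar hq, h, sub_self, zpow_zero, one_smul]

theorem lowMat_commute {sd : Bool} {r : ℕ} {x : Module.End K ((TVar →₀ ℤ) →₀ K)}
    (hx : ∀ b s j, s < r → Commute (tVar q (sd, b, s, j)) x) (i k : ℕ) :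
    Commute (lowMat q sd r i k) x := by
  induction r generalizing i with
  | zero =>
    rw [lowMat]
    split_ifs
    · exact Commute.one_left x
    · exact Commute.zero_left x
  | succ r ih =>
    have ih := fun i => ih (fun b s j hs => hx b s j (by omega)) i
    cases i with
    | zero => exact (hx _ _ _ (by omega)).mul_left (ih _)
    | succ i =>
      exact ((hx _ _ _ (by omega)).mul_left (ih _)).add_left ((hx _ _ _ (by omega)).mul_left (ih _))

theorem lowMat_commute_lowMat (hq : q ≠ 0) (r s i k j l : ℕ) :
    Commute (lowMat q true r i k) (lowMat q false s j l) :=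
  lowMat_commute (fun _ _ _ _ => (lowMat_commute (fun _ _ _ _ =>
    tVar_commute hq (by simp [tPair])) _ _).symm) _ _

theorem isQMat_bidiagonal (hq : q ≠ 0) (sd : Bool) (r m : ℕ) :
    IsQMat q fun i p : Fin m => if p = i then tVar q (sd, false, r, i) else
      if p.val + 1 = i then tVar q (sd, true, r, i) else 0 where
  row {i j k} h := by
    by_cases h1 : k = i
    · subst h1
      by_cases h2 : j.val + 1 = k
      · simp [h.ne, h2, tVar_mul_tVar hq (sd, true, r, _) (sd, false, r, _), tPair]
      · simp [h.ne, h2]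
    · by_cases h2 : k.val + 1 = i
      · have : j ≠ i := by omega
        have : j.val + 1 ≠ i := by omega
        simp [*]
      · simp [*]
  col {i k j} h := by
    by_cases h1 : j = i
    · subst h1
      by_cases h2 : j.val + 1 = k
      · simp [h.ne, ← h2, tVar_mul_tVar hq (sd, false, r, _) (sd, true, r, _), tPair]
      · simp [h.ne, h2]
    · by_cases h2 : j.val + 1 = i
      · have : j ≠ k := by omega
        have : j.val + 1 ≠ k := by omega
        have : i.val ≠ k := by omega
        simp [*]
      · simp [*]
  comm {i k j l} h1 h2 := by
    by_cases h3 : j = i ∨ j.val + 1 = i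
    · have : l ≠ k := by omega
      have : l.val + 1 ≠ k := by omega
      simp [*]
    · push Not at h3
      simp [*]
  quantum {i k j l} h1 h2 := by
    have e : (if l = i then tVar q (sd, false, r, i) else
        if l.val + 1 = i then tVar q (sd, true, r, i) else 0) *
        (if j = k then tVar q (sd, false, r, k) else
        if j.val + 1 = k then tVar q (sd, true, r, k) else 0) = 0 := by
      by_cases h3 : l = i ∨ l.val + 1 = i
      · have : j ≠ k := by omega
        have : j.val + 1 ≠ k := by omega
        simp [*]
      · push Not at h3
        simp [*]
    rw [e, smul_zero, add_zero]
    have hik : k.val ≠ i := by omega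
    have hik' : k.val + 1 ≠ i := by omega
    by_cases h3 : j = i
    · by_cases h4 : l = k
      · simpa [h3, h4] using (tVar_commute hq (by simp [tPair])).eq
      by_cases h5 : l.val + 1 = k
      · have : i.val + 1 ≠ k := by omega
        simpa [h3, h4, h5] using (tVar_commute hq (by simp [tPair, this, hik.symm])).eq
      · simp [*]
    by_cases h4 : j.val + 1 = i
    · by_cases h5 : l = k
      · simpa [h3, h4, h5] using (tVar_commute hq (by simp [tPair, hik, hik'])).eq
      by_cases h6 : l.val + 1 = k
      · simpa [h3, h4, h5, h6] using (tVar_commute hq (by simp [tPair])).eq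
      · simp [*]
    · simp [*]

theorem isQMat_lowMat (hq : q ≠ 0) (sd : Bool) (r m t : ℕ) :
    IsQMat q fun (i : Fin m) (k : Fin t) => lowMat q sd r i k := by
  induction r with
  | zero =>
    constructor
    · intro i j k h
      have : i.val = j → i.val ≠ k := by omega
      by_cases h1 : i.val = j <;> simp_all [lowMat]
    · intro i k j h
      have : i.val = j → k.val ≠ j := by omega
      by_cases h1 : i.val = j <;> simp_all [lowMat]
    · intro i k j l h1 h2
      simp only [lowMat, mul_ite, mul_one, mul_zero, ← ite_and, and_comm]
    · intro i k j l h1 h2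
      have e : ¬(k.val = j ∧ i.val = l) := by omega
      simp only [lowMat, mul_ite, mul_one, mul_zero, ← ite_and]
      rw [if_neg e, smul_zero, add_zero]
      simp only [and_comm]
  | succ r ih =>
    have := (isQMat_bidiagonal hq sd r m).mul hq ih (fun i p s k => by
      refine (lowMat_commute (fun b s j hs => ?_) _ _).eq
      have : s ≠ r := by omega
      split_ifs
      · exact tVar_commute hq (by simp [tPair, this, this.symm])
      · exact tVar_commute hq (by simp [tPair, this, this.symm])
      · exact Commute.zero_right _)
    convert this using 3 with i k
    obtain ⟨i, hi⟩ := i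
    cases i with
    | zero =>
      rw [Finset.sum_eq_single_of_mem ⟨0, hi⟩ (Finset.mem_univ _)]
      · simp [lowMat]
      · intro p _ hp
        simp [hp]
    | succ i =>
      rw [Finset.sum_eq_add (⟨i + 1, hi⟩ : Fin m) ⟨i, by omega⟩ (by simp)]
      · simp [lowMat]
      · rintro p - ⟨hp, hp'⟩
        have : p.val ≠ i := fun h => hp' (Fin.ext h)
        simp [hp, this]
      · simp
      · simp

theorem lowMat_eq_zero (sd : Bool) (r i k : ℕ) (h : i < k ∨ k + r < i) :
    lowMat q sd r i k = 0 := by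
  induction r generalizing i with
  | zero => rw [lowMat, if_neg (by omega)]
  | succ r ih =>
    cases i with
    | zero => rw [lowMat, ih _ (by omega), mul_zero]
    | succ i => rw [lowMat, ih _ (by omega), ih _ (by omega), mul_zero, mul_zero, add_zero]

theorem tWt_lowLead (M : ℤ) (sd : Bool) (r i k : ℕ) (h : k ≤ i) (h' : i ≤ k + r) :
    tWt M (lowLead sd r i k) = (i - k) * (M + r - 1 - i) := by
  induction r generalizing i with
  | zero =>
    obtain rfl : i = k := by omega
    simp [lowLead]
  | succ r ih =>
    rw [lowLead]
    split_ifs with hk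
    · rw [map_add, ih _ (by omega) (by omega), tWt_single]
      push_cast [show 1 ≤ i by omega]
      simp only [if_true]
      ring
    · obtain rfl : i = k := by omega
      rw [map_add, ih _ (by omega) (by omega), tWt_single]
      simp

theorem hasLead_lowMat (hq : q ≠ 0) (M : ℤ) (sd : Bool) (r i k : ℕ) (h : k ≤ i)
    (h' : i ≤ k + r) :
    HasLead q tForm (tWt M) (lowMat q sd r i k) (lowLead sd r i k) := by
  induction r generalizing i with
  | zero =>
    obtain rfl : i = k := by omega
    simpa [lowMat, lowLead] using hasLead_one
  | succ r ih =>
    by_cases hk : k < i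
    · obtain ⟨i, rfl⟩ : ∃ j, i = j + 1 := ⟨i - 1, by omega⟩
      rw [lowMat, lowLead, if_pos hk, add_comm, Nat.add_sub_cancel]
      refine ((hasLead_monOp _).mul hq (ih i (by omega) (by omega))).add_lower ?_
      by_cases hr : i + 1 ≤ k + r
      · refine wtSpan_mono ?_ (wtSpan_mul hq (monOp_mem_wtSpan le_rfl)
          (ih (i + 1) h hr).mem)
        rw [map_add, tWt_single, tWt_single, tWt_lowLead _ _ _ _ _ h hr,
          tWt_lowLead _ _ _ _ _ (by omega) (by omega)]
        simp only [if_true, Bool.false_eq_true, if_false]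
        push_cast
        have : (k : ℤ) ≤ i := by omega
        linarith
      · rw [lowMat_eq_zero _ _ _ _ (by omega), mul_zero]
        exact Submodule.zero_mem _
    · obtain rfl : i = k := by omega
      rw [lowLead, if_neg hk]
      have := (hasLead_monOp (q := q) (B := tForm) (wt := tWt M)
        (Finsupp.single (sd, false, r, i) 1)).mul hq (ih i (by omega) (by omega))
      cases i with
      | zero => exact this
      | succ i => rwa [lowMat, lowMat_eq_zero _ _ i _ (by omega), mul_zero, add_zero]

theorem lowLead_apply_eq_zero (sd : Bool) (r i k : ℕ) {u : TVar}
    (h : u.1 ≠ sd ∨ r ≤ u.2.2.1) : lowLead sd r i k u = 0 := by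
  induction r generalizing i with
  | zero => simp [lowLead]
  | succ r ih =>
    have ih := fun i => ih i (h.imp_right fun h => by omega)
    have : ∀ b j, (sd, b, r, j) ≠ u := by
      rintro b j rfl
      rcases h with h | h
      · exact h rfl
      · simp at h
    rw [lowLead]
    split_ifs <;> simp [ih, this]

theorem lowLead_apply_true (sd : Bool) (r s i k j : ℕ) (hs : s < r) (hk : k ≤ i) :
    lowLead sd r i k (sd, true, r - 1 - s, j) = if i = j + s ∧ k < j then 1 else 0 := by
  induction r generalizing i s with
  | zero => omega
  | succ r ih =>
    rw [lowLead]
    cases s with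
    | zero =>
      split_ifs with h1 h2 h2
      · simp [lowLead_apply_eq_zero, h2.1]
      · have : i ≠ j := by omega
        simp [lowLead_apply_eq_zero, this]
      · omega
      · simp [lowLead_apply_eq_zero]
    | succ s =>
      have e : r + 1 - 1 - (s + 1) = r - 1 - s := by omega
      have e' : r ≠ r - 1 - s := by omega
      by_cases h1 : k < i
      · rw [if_pos h1, e, Finsupp.add_apply, ih s (i - 1) (by omega) (by omega)]
        simp [e']
        congr 1
        apply propext
        omega
      · rw [if_neg h1, e, Finsupp.add_apply, ih s i (by omega) (by omega)]
        rw [if_neg (by omega), if_neg (by omega)]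
        simp

theorem lowLead_apply_false (sd : Bool) (r i k j : ℕ) (hk : k ≤ i) :
    lowLead sd (r + 1) i k (sd, false, r, j) = if i = j ∧ k = j then 1 else 0 := by
  rw [lowLead]
  split_ifs with h1 h2 h2
  · omega
  · simp [lowLead_apply_eq_zero]
  · simp [lowLead_apply_eq_zero, h2.2]
  · have : k ≠ j := by omega
    simp [lowLead_apply_eq_zero, this]

end LowMat

/-- The alternating sum `Σ_σ (-q)^{ℓ(σ)} z_{p 0, C (σ 0)} ⋯ z_{p (h-1), C (σ (h-1))}`. -/
def qAlt {K : Type} [Field K] (q : K) {W : Type} [Semiring W] [Algebra K W] {κ ν : Type}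
    (z : κ → ν → W) {h : ℕ} (p : Fin h → κ) (C : Fin h → ν) : W :=
  ∑ σ : Equiv.Perm (Fin h), (-q) ^ invCount σ • (List.ofFn fun a => z (p a) (C (σ a))).prod

theorem invCount_mul_swap {h : ℕ} (σ : Equiv.Perm (Fin h)) {a b : Fin h} (hab : a.val + 1 = b)
    (hσ : σ a < σ b) : invCount (σ * Equiv.swap a b) = invCount σ + 1 := by
  have key : (Finset.univ.filter fun p : Fin h × Fin h =>
      p.1 < p.2 ∧ (σ * Equiv.swap a b) p.2 < (σ * Equiv.swap a b) p.1) =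
      insert (a, b) ((Finset.univ.filter fun p : Fin h × Fin h => p.1 < p.2 ∧ σ p.2 < σ p.1).map
        ((Equiv.swap a b).prodCongr (Equiv.swap a b)).toEmbedding) := by
    ext ⟨x, y⟩
    have hne : a ≠ b := by omega
    rw [Finset.mem_insert, Finset.mem_map_equiv, Finset.mem_filter, Finset.mem_filter]
    simp only [Finset.mem_univ, true_and, Prod.mk.injEq, Equiv.prodCongr_symm, Equiv.symm_swap, Equiv.prodCongr_apply,
      Prod.map, Equiv.Perm.mul_apply]
    rcases eq_or_ne x a with rfl | hxa
    · rcases eq_or_ne y b with rfl | hyb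
      · simp only [Equiv.swap_apply_left, Equiv.swap_apply_right]
        simp [hσ]
        omega
      rcases eq_or_ne y x with rfl | hya
      · simp [hne]
      · rw [Equiv.swap_apply_left, Equiv.swap_apply_of_ne_of_ne hya hyb]
        simp only [hyb, and_false, false_or]
        exact and_congr_left fun _ => by omega
    rcases eq_or_ne x b with rfl | hxb
    · rcases eq_or_ne y x with rfl | hyb
      · simp [hne.symm]
      rcases eq_or_ne y a with rfl | hya
      · simp only [Equiv.swap_apply_left, Equiv.swap_apply_right]
        simp [hσ.not_gt, hne.symm]
      · rw [Equiv.swap_apply_right, Equiv.swap_apply_of_ne_of_ne hya hyb]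
        simp only [hyb, and_false, false_or]
        exact and_congr_left fun _ => by omega
    rw [Equiv.swap_apply_of_ne_of_ne hxa hxb]
    simp only [hxa, false_and, false_or]
    rcases eq_or_ne y a with rfl | hya
    · rw [Equiv.swap_apply_left]
      exact and_congr_left fun _ => by omega
    rcases eq_or_ne y b with rfl | hyb
    · rw [Equiv.swap_apply_right]
      exact and_congr_left fun _ => by omega
    rw [Equiv.swap_apply_of_ne_of_ne hya hyb]
  rw [invCount, key, Finset.card_insert_of_notMem, Finset.card_map, invCount]
  simp only [Finset.mem_map_equiv, Finset.mem_filter, Equiv.prodCongr_symm, Equiv.symm_swap,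
    Equiv.prodCongr_apply, Prod.map, Equiv.swap_apply_left, Equiv.swap_apply_right]
  omega

theorem exists_ofFn_prod_eq {W : Type} [Monoid W] {h : ℕ} {a b : Fin h} (hab : a.val + 1 = b)
    (f : Fin h → W) : ∃ l r : W, ∀ g : Fin h → W, (∀ x, x ≠ a → x ≠ b → g x = f x) →
      (List.ofFn g).prod = l * (g a * g b) * r := by
  refine ⟨((List.ofFn f).take a).prod, ((List.ofFn f).drop (a + 2)).prod, fun g hg => ?_⟩
  have e : List.ofFn g = (List.ofFn f).take a ++ ([g a, g b] ++ (List.ofFn f).drop (a + 2)) := by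
    have e1 : (List.ofFn f).take a = (List.ofFn g).take a := by
      apply List.ext_getElem
      · simp
      · intro x h1 h2
        simp only [List.length_take, List.length_ofFn] at h1
        simp only [List.getElem_take, List.getElem_ofFn]
        refine (hg _ ?_ ?_).symm <;> rw [Ne, Fin.ext_iff] <;> simp only <;> omega
    have e2 : (List.ofFn f).drop (a + 2) = (List.ofFn g).drop (a + 2) := by
      apply List.ext_getElem
      · simp
      · intro x h1 h2
        simp only [List.getElem_drop, List.getElem_ofFn]
        refine (hg _ ?_ ?_).symm <;> rw [Ne, Fin.ext_iff] <;> simp only <;> omega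
    have e3 : [g a, g b] ++ (List.ofFn g).drop (a + 2) = (List.ofFn g).drop a := by
      rw [List.drop_eq_getElem_cons (i := a) (by simp), List.drop_eq_getElem_cons (i := a + 1) (by simp; omega)]
      have : min (a.val + 2) h = a + 2 := by omega
      simp [hab, this]
    rw [e1, e2, e3, List.take_append_drop]
  conv_lhs => rw [e]
  simp [mul_assoc]

section QAlt

variable {K : Type} [Field K] {q : K} {W : Type} [Semiring W] [Algebra K W] {κ ν : Type}
  [LinearOrder κ] [LinearOrder ν] {z : κ → ν → W} {h : ℕ} {p : Fin h → κ} {C : Fin h → ν}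

theorem sum_perm_eq_zero_of_swap {a b : Fin h} (hab : a ≠ b) {F : Equiv.Perm (Fin h) → W}
    (hF : ∀ σ, σ a < σ b → F σ + F (σ * Equiv.swap a b) = 0) : ∑ σ, F σ = 0 := by
  refine Finset.sum_involution (fun σ _ => σ * Equiv.swap a b) ?_ ?_ (by simp) ?_
  · intro σ _
    rcases lt_trichotomy (σ a) (σ b) with h1 | h1 | h1
    · exact hF σ h1
    · exact absurd (σ.injective h1) hab
    · have := hF (σ * Equiv.swap a b) (by simpa using h1)
      rwa [mul_assoc, Equiv.swap_mul_self, mul_one, add_comm] at this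
  · intro σ _ _ h1
    rw [mul_eq_left] at h1
    exact hab (Equiv.swap_eq_one_iff.1 h1)
  · intro σ _
    simp [mul_assoc]

theorem qAlt_eq_zero_of_adjacent (hz : IsQMat q z) (hC : StrictMono C) {a b : Fin h}
    (hab : a.val + 1 = b) (hp : p a = p b) : qAlt q z p C = 0 := by
  have hne : a ≠ b := by omega
  refine sum_perm_eq_zero_of_swap hne fun σ hσ => ?_
  obtain ⟨l, r, hlr⟩ := exists_ofFn_prod_eq hab fun x => z (p x) (C (σ x))
  rw [hlr _ fun _ _ _ => rfl, hlr (fun x => z (p x) (C ((σ * Equiv.swap a b) x))) fun x h1 h2 => by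
    simp [Equiv.swap_apply_of_ne_of_ne h1 h2], invCount_mul_swap σ hab hσ]
  simp only [Equiv.Perm.mul_apply, Equiv.swap_apply_left, Equiv.swap_apply_right, hp]
  rw [hz.row (hC hσ)]
  simp only [mul_smul_comm, smul_mul_assoc, smul_smul, ← add_smul]
  rw [pow_succ]
  simp

theorem qAlt_comp_swap (hq : q ≠ 0) (hz : IsQMat q z) (hC : StrictMono C) {a b : Fin h}
    (hab : a.val + 1 = b) (hp : p a < p b) :
    qAlt q z (p ∘ Equiv.swap a b) C + q • qAlt q z p C = 0 := by
  have hne : a ≠ b := by omega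
  rw [qAlt, qAlt, Finset.smul_sum, ← Finset.sum_add_distrib]
  refine sum_perm_eq_zero_of_swap hne fun σ hσ => ?_
  obtain ⟨l, r, hlr⟩ := exists_ofFn_prod_eq hab fun x => z (p x) (C (σ x))
  rw [hlr _ fun _ _ _ => rfl, hlr (fun x => z (p x) (C ((σ * Equiv.swap a b) x))) fun x h1 h2 => by
    simp [Equiv.swap_apply_of_ne_of_ne h1 h2],
    hlr (fun x => z ((p ∘ Equiv.swap a b) x) (C (σ x))) fun x h1 h2 => by
      simp [Equiv.swap_apply_of_ne_of_ne h1 h2],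
    hlr (fun x => z ((p ∘ Equiv.swap a b) x) (C ((σ * Equiv.swap a b) x))) fun x h1 h2 => by
      simp [Equiv.swap_apply_of_ne_of_ne h1 h2], invCount_mul_swap σ hab hσ]
  simp only [Equiv.Perm.mul_apply, Function.comp_apply, Equiv.swap_apply_left,
    Equiv.swap_apply_right]
  rw [hz.quantum hp (hC hσ), hz.comm hp (hC hσ)]
  simp only [mul_add, add_mul, smul_add, mul_smul_comm, smul_mul_assoc, smul_smul]
  rw [pow_succ]
  match_scalars <;> field_simp <;> ring

theorem qAlt_eq_zero (hq : q ≠ 0) (hz : IsQMat q z) (hC : StrictMono C)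
    (hp : ¬Function.Injective p) : qAlt q z p C = 0 := by
  obtain ⟨a, b, hab, hne⟩ : ∃ a b, a < b ∧ p a = p b := by
    simp only [Function.Injective, not_forall] at hp
    obtain ⟨a, b, h1, h2⟩ := hp
    rcases lt_or_gt_of_ne h2 with h3 | h3
    · exact ⟨a, b, h3, h1⟩
    · exact ⟨b, a, h3, h1.symm⟩
  clear hp
  obtain ⟨b, hb⟩ := b
  induction b using Nat.strong_induction_on generalizing p with
  | _ b ih =>
  by_cases h1 : a.val + 1 = b
  · exact qAlt_eq_zero_of_adjacent hz hC (b := ⟨b, hb⟩) h1 hne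
  simp only [Fin.lt_def] at hab
  obtain ⟨b, rfl⟩ : ∃ c, b = c + 1 := ⟨b - 1, by omega⟩
  have e : ∀ p : Fin h → κ, p a = p ⟨b + 1, hb⟩ → 
      qAlt q z (p ∘ Equiv.swap ⟨b, by omega⟩ ⟨b + 1, hb⟩) C = 0 := by
    intro p hne
    refine ih b (by omega) (by omega) (by simp only [Fin.lt_def]; omega) ?_
    rw [Function.comp_apply, Function.comp_apply, Equiv.swap_apply_left,
      Equiv.swap_apply_of_ne_of_ne, hne] <;> rw [Ne, Fin.ext_iff] <;> simp only <;> omega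
  rcases lt_trichotomy (p ⟨b, by omega⟩) (p ⟨b + 1, hb⟩) with h2 | h2 | h2
  · have h3 := e p hne
    have h4 := qAlt_comp_swap hq hz hC rfl h2
    rw [h3, zero_add] at h4
    rw [← inv_smul_smul₀ hq (qAlt q z p C), h4, smul_zero]
  · exact qAlt_eq_zero_of_adjacent hz hC rfl h2
  · have h3 := qAlt_comp_swap (p := p ∘ Equiv.swap ⟨b, by omega⟩ ⟨b + 1, hb⟩) hq hz hC
      (a := ⟨b, by omega⟩) (b := ⟨b + 1, hb⟩) rfl (by simpa using h2)
    rw [e p hne, smul_zero, add_zero] at h3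
    rw [← h3]
    congr 1
    ext x
    simp

end QAlt

theorem sum_range_le_sum_finset (s : Finset ℕ) : ∑ i ∈ Finset.range s.card, i ≤ ∑ i ∈ s, i := by
  induction s using Finset.induction_on_max with
  | empty => simp
  | insert a s hs ih =>
    have ha : a ∉ s := fun h => (hs a h).false
    rw [Finset.sum_insert ha, Finset.card_insert_of_notMem ha, Finset.sum_range_succ, add_comm]
    refine Nat.add_le_add ?_ ih
    have : s ⊆ Finset.range a := fun x hx => Finset.mem_range.2 (hs x hx)
    simpa using Finset.card_le_card this

theorem sum_val_le_sum_of_injective {h : ℕ} {p : Fin h → ℕ} (hp : Function.Injective p) :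
    ∑ a : Fin h, (a : ℕ) ≤ ∑ a, p a := by
  have := sum_range_le_sum_finset (Finset.univ.map ⟨p, hp⟩)
  rwa [Finset.card_map, Finset.card_univ, Fintype.card_fin, Finset.sum_map,
    Finset.sum_range] at this

/-- A rearrangement inequality for strictly decreasing positive coefficients. -/
theorem sum_mul_val_le_sum_mul {h : ℕ} {c : Fin h → ℤ} (hc : StrictAnti c) (hc' : ∀ a, 0 < c a)
    {p : Fin h → ℕ} (hp : Function.Injective p) :
    ∑ a, c a * (a : ℕ) ≤ ∑ a, c a * p a ∧
      (∑ a, c a * p a = ∑ a, c a * (a : ℕ) → ∀ a, p a = a) := by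
  induction h with
  | zero => exact ⟨by simp, fun _ a => a.elim0⟩
  | succ h ih =>
    have e : ∀ p : Fin (h + 1) → ℕ, ∑ a, c a * p a =
        ∑ a : Fin h, (c a.castSucc - c (Fin.last h)) * p a.castSucc +
          c (Fin.last h) * ((∑ a, p a : ℕ) : ℤ) := by
      intro p
      rw [Fin.sum_univ_castSucc, Fin.sum_univ_castSucc]
      push_cast
      rw [mul_add, Finset.mul_sum, ← add_assoc, ← Finset.sum_add_distrib]
      simp only [sub_mul, sub_add_cancel]
    have ih := ih (c := fun a => c a.castSucc - c (Fin.last h))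
      (fun a b hab => sub_lt_sub_right (hc (Fin.castSucc_lt_castSucc_iff.2 hab)) _)
      (fun a => sub_pos.2 (hc (Fin.castSucc_lt_last a)))
      (hp.comp (Fin.castSucc_injective h))
    have h1 := sum_val_le_sum_of_injective hp
    have hpos := hc' (Fin.last h)
    rw [e p, e fun a => a]
    have h2 : c (Fin.last h) * ((∑ a : Fin (h + 1), (a : ℕ) : ℕ) : ℤ) ≤
        c (Fin.last h) * ((∑ a, p a : ℕ) : ℤ) :=
      mul_le_mul_of_nonneg_left (by exact_mod_cast h1) hpos.le
    refine ⟨add_le_add ih.1 h2, fun h3 => ?_⟩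
    have h4 := ih.1
    simp only [Function.comp_apply, Fin.val_castSucc] at ih h3 h4
    have h5 := ih.2 (by linarith)
    have h6 : ((∑ a, p a : ℕ) : ℤ) = ((∑ a : Fin (h + 1), (a : ℕ) : ℕ) : ℤ) :=
      mul_left_cancel₀ hpos.ne' (by linarith)
    rw [Nat.cast_inj, Fin.sum_univ_castSucc, Fin.sum_univ_castSucc] at h6
    simp only [h5, Fin.val_castSucc, add_right_inj] at h6
    intro a
    induction a using Fin.lastCases with
    | last => exact h6
    | cast a => exact h5 a

theorem ofFn_prod_sum {W : Type} [Semiring W] {h : ℕ} {κ : Type} [Fintype κ]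
    (g : Fin h → κ → W) : (List.ofFn fun a => ∑ k, g a k).prod =
      ∑ p : Fin h → κ, (List.ofFn fun a => g a (p a)).prod := by
  have := (MultilinearMap.mkPiAlgebraFin ℕ h W).map_sum fun a k => g a k
  simpa only [MultilinearMap.mkPiAlgebraFin_apply] using this

theorem ofFn_prod_mul_of_commute {W : Type} [Monoid W] {h : ℕ} {f g : Fin h → W}
    (hfg : ∀ a b, Commute (f a) (g b)) :
    (List.ofFn fun a => f a * g a).prod = (List.ofFn f).prod * (List.ofFn g).prod := by
  induction h with
  | zero => simp
  | succ h ih =>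
    simp only [List.ofFn_succ, List.prod_cons]
    have : Commute (g 0) (List.ofFn fun a : Fin h => f a.succ).prod :=
      Commute.list_prod_right _ _ fun x hx => by
        obtain ⟨a, rfl⟩ := List.mem_ofFn.1 hx
        exact (hfg _ _).symm
    rw [ih fun a b => hfg _ _, mul_assoc, ← mul_assoc (g 0), this.eq]
    simp only [mul_assoc]

/-- The leading exponent of the image of a quantum minor. -/
def minorLead (m n : ℕ) {h : ℕ} (R : Fin h → Fin m) (C : Fin h → Fin n) : TVar →₀ ℤ :=
  ∑ a, lowLead false m (R a) a + ∑ a, lowLead true n (C a) a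

/-- The factorisation of a matrix of rank at most `t` over the quantum torus. -/
def torusMat {K : Type} [Field K] (q : K) (m n t : ℕ) (i : Fin m) (j : Fin n) :
    Module.End K ((TVar →₀ ℤ) →₀ K) :=
  ∑ k : Fin t, lowMat q false m i k * lowMat q true n j k

section MinorLead

variable {K : Type} [Field K] {q : K}

theorem lowMat_mem_wtSpan (hq : q ≠ 0) (sd : Bool) {r i : ℕ} (k : ℕ) (hi : i < r) :
    lowMat q sd r i k ∈ wtSpan q tForm (tWt 1) ((i - k) * (r - i)) := by
  by_cases h : k ≤ i
  · have := (hasLead_lowMat hq 1 sd r i k h (by omega)).mem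
    rwa [tWt_lowLead _ _ _ _ _ h (by omega), show (1 : ℤ) + r - 1 - i = r - i by ring] at this
  · rw [lowMat_eq_zero _ _ _ _ (by omega)]
    exact Submodule.zero_mem _

theorem val_le_of_strictMono {h m : ℕ} {R : Fin h → Fin m} (hR : StrictMono R) (a : Fin h) :
    (a : ℕ) ≤ R a := by
  obtain ⟨a, ha⟩ := a
  induction a with
  | zero => simp
  | succ a ih =>
    have h1 := ih (by omega)
    have h2 : R ⟨a, by omega⟩ < R ⟨a + 1, ha⟩ := hR (by simp [Fin.lt_def])
    simp only [Fin.lt_def] at h1 h2 ⊢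
    omega

theorem ofFn_lowMat_mem_wtSpan (hq : q ≠ 0) (sd : Bool) {h m : ℕ} {R : Fin h → Fin m}
    (hR : StrictMono R) {p : Fin h → ℕ} (hp : Function.Injective p) (σ : Equiv.Perm (Fin h)) :
    (List.ofFn fun a => lowMat q sd m (R (σ a)) (p a)).prod ∈
        wtSpan q tForm (tWt 1) (tWt 1 (∑ a, lowLead sd m (R a) a)) ∧
      ((∃ a, p a ≠ σ a) → (List.ofFn fun a => lowMat q sd m (R (σ a)) (p a)).prod ∈
        wtSpan q tForm (tWt 1) (tWt 1 (∑ a, lowLead sd m (R a) a) - 1)) := by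
  have h0 := ofFn_prod_mem_wtSpan hq fun a => lowMat_mem_wtSpan hq sd (p a) (R (σ a)).2
  have e1 : tWt 1 (∑ a, lowLead sd m (R a) a) =
      ∑ a, (((R a : ℕ) : ℤ) - (a : ℕ)) * (m - (R a : ℕ)) := by
    rw [map_sum]
    refine Finset.sum_congr rfl fun a _ => ?_
    rw [tWt_lowLead _ _ _ _ _ (val_le_of_strictMono hR a) (by omega)]
    ring
  have e2 : ∑ a, (((R (σ a) : ℕ) : ℤ) - (p a : ℕ)) * (m - (R (σ a) : ℕ)) =
      ∑ a, (((R a : ℕ) : ℤ) - (p (σ.symm a) : ℕ)) * (m - (R a : ℕ)) := by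
    rw [← Equiv.sum_comp σ fun a => (((R a : ℕ) : ℤ) - (p (σ.symm a) : ℕ)) * (m - (R a : ℕ))]
    simp
  rw [e2] at h0
  have h1 := sum_mul_val_le_sum_mul (c := fun a => (m : ℤ) - (R a : ℕ))
    (fun a b hab => by
      have : R a < R b := hR hab
      simp only [Fin.lt_def] at this
      change (m : ℤ) - (R b : ℕ) < m - (R a : ℕ)
      omega) (fun a => by omega) (hp.comp σ.symm.injective)
  rw [e1]
  simp only [mul_comm _ ((m : ℤ) - _), mul_sub ((m : ℤ) - _), Finset.sum_sub_distrib] at h0 ⊢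
  simp only [Function.comp_apply] at h1
  refine ⟨wtSpan_mono (by linarith [h1.1]) h0, fun ⟨a, ha⟩ => wtSpan_mono ?_ h0⟩
  have h2 := lt_of_le_of_ne h1.1 fun h2 => by
    have := h1.2 h2.symm (σ a)
    simp at this
    exact ha this
  linarith

theorem hasLead_qAlt_torusMat (hq : q ≠ 0) {m n t h : ℕ} (ht : h ≤ t) {R : Fin h → Fin m}
    {C : Fin h → Fin n} (hR : StrictMono R) (hC : StrictMono C) :
    HasLead q tForm (tWt 1) (qAlt q (torusMat q m n t) R C) (minorLead m n R C) := by
  have hY : ∀ (p : Fin h → Fin t) (σ : Equiv.Perm (Fin h)),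
      (List.ofFn fun a => lowMat q false m (R a) (p a) * lowMat q true n (C (σ a)) (p a)).prod =
        (List.ofFn fun a => lowMat q false m (R a) (p a)).prod *
          (List.ofFn fun a => lowMat q true n (C (σ a)) (p a)).prod := fun p σ =>
    ofFn_prod_mul_of_commute fun a b => (lowMat_commute_lowMat hq _ _ _ _ _ _).symm
  have e : qAlt q (torusMat q m n t) R C = ∑ p : Fin h → Fin t,
      (List.ofFn fun a => lowMat q false m (R a) (p a)).prod *
        qAlt q (fun (k : Fin t) (j : Fin n) => lowMat q true n j k) p C := by
    simp only [qAlt, torusMat, ofFn_prod_sum, hY, Finset.smul_sum, Finset.mul_sum, mul_smul_comm]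
    exact Finset.sum_comm
  have hinj : Function.Injective fun a : Fin h => (Fin.castLE ht a : ℕ) :=
    Fin.val_injective.comp (Fin.castLE_injective ht)
  have hlead : ∀ sd {m : ℕ} {R : Fin h → Fin m}, StrictMono R →
      HasLead q tForm (tWt 1) (List.ofFn fun a => lowMat q sd m (R a) a).prod
        (∑ a, lowLead sd m (R a) a) := fun sd m R hR =>
    hasLead_ofFn_prod hq fun a => hasLead_lowMat hq 1 sd _ _ _ (val_le_of_strictMono hR a)
      (by have := (R a).2; omega)
  rw [e, Fintype.sum_eq_add_sum_compl (Fin.castLE ht), qAlt, Fintype.sum_eq_add_sum_compl 1,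
    mul_add, add_assoc]
  refine HasLead.add_lower ?_ (Submodule.add_mem _ ?_ ?_)
  · have h1 : invCount (1 : Equiv.Perm (Fin h)) = 0 := by
      rw [invCount, Finset.card_eq_zero, Finset.filter_eq_empty_iff]
      exact fun p _ hp => hp.1.asymm hp.2
    rw [mul_smul_comm, h1]
    simpa [minorLead] using (hlead false hR).mul hq (hlead true hC)
  · rw [Finset.mul_sum]
    refine Submodule.sum_mem _ fun σ hσ => ?_
    rw [mul_smul_comm]
    refine Submodule.smul_mem _ _ (wtSpan_mono ?_ (wtSpan_mul hq (hlead false hR).mem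
      ((ofFn_lowMat_mem_wtSpan hq true hC hinj σ).2 ?_)))
    · rw [minorLead, map_add]
      omega
    · by_contra! h1
      rw [Finset.mem_compl, Finset.mem_singleton] at hσ
      exact hσ (Equiv.ext fun a => Fin.ext (h1 a).symm)
  · refine Submodule.sum_mem _ fun p hp => ?_
    rw [Finset.mem_compl, Finset.mem_singleton] at hp
    by_cases hpi : Function.Injective p
    · rw [qAlt, Finset.mul_sum]
      refine Submodule.sum_mem _ fun σ hσ => ?_
      rw [mul_smul_comm]
      have hpi' : Function.Injective fun a => (p a : ℕ) := Fin.val_injective.comp hpi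
      have h1 := (ofFn_lowMat_mem_wtSpan hq false hR hpi' 1).2 (by
        by_contra! h1
        exact hp (funext fun a => Fin.ext (h1 a)))
      have h2 := (ofFn_lowMat_mem_wtSpan hq true hC hpi' σ).1
      refine Submodule.smul_mem _ _ (wtSpan_mono ?_ (wtSpan_mul hq h1 h2))
      rw [minorLead, map_add]
      omega
    · rw [qAlt_eq_zero hq (isQMat_lowMat hq true n n t).transpose hC hpi, mul_zero]
      exact Submodule.zero_mem _

end MinorLead

/-- The carries of the local growth rule `growthRule`. -/
def growthCarry (μ ρ ν : ℕ → ℕ) (a : ℕ) : ℕ → ℕ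
  | 0 => a
  | c + 1 =>
    if ρ c = ν c then
      if ρ c = μ c then growthCarry μ ρ ν a c - 1 else growthCarry μ ρ ν a c + 1
    else growthCarry μ ρ ν a c

/-- The local growth rule of the Robinson–Schensted–Knuth correspondence, for partitions given
by the heights of their columns. -/
def growthRule (μ ρ ν : ℕ → ℕ) (a : ℕ) (c : ℕ) : ℕ :=
  if ρ c = ν c ∧ ρ c = μ c then
    if 0 < growthCarry μ ρ ν a c then μ c + 1 else μ c
  else max (ρ c) (ν c)

/-- The growth diagram of a matrix of natural numbers. -/
def growth (A : ℕ → ℕ → ℕ) : ℕ → ℕ → ℕ → ℕ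
  | 0, _ => fun _ => 0
  | _ + 1, 0 => fun _ => 0
  | i + 1, j + 1 => growthRule (growth A i j) (growth A i (j + 1)) (growth A (i + 1) j) (A i j)

/-- The partition `ρ` is obtained from `μ` by adding a horizontal strip. -/
def Interlace (μ ρ : ℕ → ℕ) : Prop := ∀ c, μ c ≤ ρ c ∧ ρ c ≤ μ c + 1

section GrowthRule

variable {μ ρ ν : ℕ → ℕ} {a : ℕ}

theorem growthCarry_succ (c : ℕ) : growthCarry μ ρ ν a (c + 1) =
    if ρ c = ν c then
      if ρ c = μ c then growthCarry μ ρ ν a c - 1 else growthCarry μ ρ ν a c + 1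
    else growthCarry μ ρ ν a c := rfl

theorem growthRule_comm : growthRule μ ρ ν a = growthRule μ ν ρ a ∧
    growthCarry μ ρ ν a = growthCarry μ ν ρ a := by
  have h : ∀ c, growthCarry μ ρ ν a c = growthCarry μ ν ρ a c := by
    intro c
    induction c with
    | zero => rfl
    | succ c ih =>
      rw [growthCarry_succ, growthCarry_succ, ih]
      split_ifs <;> omega
  refine ⟨?_, funext h⟩
  funext c
  rw [growthRule, growthRule, h]
  split_ifs <;> omega

theorem Interlace.growthRule (hρ : Interlace μ ρ) (hν : Interlace μ ν) :
    Interlace ρ (growthRule μ ρ ν a) := by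
  intro c
  have h1 := hρ c
  have h2 := hν c
  rw [_root_.growthRule]
  split_ifs <;> omega

theorem Interlace.growthRule' (hρ : Interlace μ ρ) (hν : Interlace μ ν) :
    Interlace ν (_root_.growthRule μ ρ ν a) := by
  rw [growthRule_comm.1]
  exact hν.growthRule hρ

theorem antitone_growthRule (hρ : Interlace μ ρ) (hν : Interlace μ ν) (hμ' : Antitone μ)
    (hρ' : Antitone ρ) (hν' : Antitone ν) : Antitone (growthRule μ ρ ν a) := by
  refine antitone_nat_of_succ_le fun c => ?_
  have h1 := hρ c
  have h2 := hν c
  have h3 := hρ (c + 1)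
  have h4 := hν (c + 1)
  have h5 := hρ' c.le_succ
  have h6 := hν' c.le_succ
  have h7 := hμ' c.le_succ
  simp only [Nat.succ_eq_add_one] at h5 h6 h7
  rw [growthRule, growthRule, growthCarry_succ]
  split_ifs <;> omega

theorem sum_growthRule (hρ : Interlace μ ρ) (hν : Interlace μ ν) (N : ℕ) :
    ∑ c ∈ Finset.range N, growthRule μ ρ ν a c + growthCarry μ ρ ν a N +
        ∑ c ∈ Finset.range N, μ c =
      ∑ c ∈ Finset.range N, ρ c + ∑ c ∈ Finset.range N, ν c + a := by
  induction N with
  | zero => simp [growthCarry]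
  | succ N ih =>
    have h1 := hρ N
    have h2 := hν N
    simp only [Finset.sum_range_succ]
    rw [growthRule, growthCarry_succ]
    split_ifs <;> omega

theorem eventually_growthCarry (hμ : ∀ᶠ c in Filter.atTop, μ c = 0)
    (hρ : ∀ᶠ c in Filter.atTop, ρ c = 0) (hν : ∀ᶠ c in Filter.atTop, ν c = 0) :
    ∀ᶠ c in Filter.atTop, growthCarry μ ρ ν a c = 0 := by
  obtain ⟨N, hN⟩ := Filter.eventually_atTop.1 (hμ.and (hρ.and hν))
  have h : ∀ k, growthCarry μ ρ ν a (N + k) = growthCarry μ ρ ν a N - k := by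
    intro k
    induction k with
    | zero => rfl
    | succ k ih =>
      obtain ⟨h1, h2, h3⟩ := hN (N + k) (by omega)
      rw [← add_assoc, growthCarry_succ, ih, h1, h2, h3]
      simp
      omega
  refine Filter.eventually_atTop.2 ⟨N + growthCarry μ ρ ν a N, fun c hc => ?_⟩
  obtain ⟨k, rfl⟩ : ∃ k, c = N + k := ⟨c - N, by omega⟩
  rw [h]
  omega

theorem growthRule_injective {μ' : ℕ → ℕ} {a' : ℕ} (hμ : ∀ᶠ c in Filter.atTop, μ c = 0)
    (hμ' : ∀ᶠ c in Filter.atTop, μ' c = 0)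
    (hρ : ∀ᶠ c in Filter.atTop, ρ c = 0) (hν : ∀ᶠ c in Filter.atTop, ν c = 0)
    (h1 : Interlace μ ρ) (h2 : Interlace μ ν) (h1' : Interlace μ' ρ) (h2' : Interlace μ' ν)
    (h : growthRule μ ρ ν a = growthRule μ' ρ ν a') : μ = μ' ∧ a = a' := by
  obtain ⟨N, hN⟩ := Filter.eventually_atTop.1 ((eventually_growthCarry (a := a) hμ hρ hν).and
    (eventually_growthCarry (a := a') hμ' hρ hν))
  have step : ∀ c, growthCarry μ ρ ν a (c + 1) = growthCarry μ' ρ ν a' (c + 1) →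
      growthCarry μ ρ ν a c = growthCarry μ' ρ ν a' c ∧ μ c = μ' c := by
    intro c h3
    have h1 := h1 c
    have h2 := h2 c
    have h1' := h1' c
    have h2' := h2' c
    have h := congrFun h c
    rw [growthRule, growthRule] at h
    rw [growthCarry_succ, growthCarry_succ] at h3
    split_ifs at h h3 <;> omega
  have key : ∀ c, growthCarry μ ρ ν a c = growthCarry μ' ρ ν a' c := by
    intro c
    by_cases hc : N ≤ c
    · rw [(hN c hc).1, (hN c hc).2]
    · exact Nat.decreasingInduction (motive := fun c _ => growthCarry μ ρ ν a c =
        growthCarry μ' ρ ν a' c) (fun c _ hc => (step c hc).1)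
        ((hN N le_rfl).1.trans (hN N le_rfl).2.symm) (not_le.1 hc).le
  exact ⟨funext fun c => (step c (key _)).2, key 0⟩

end GrowthRule

section Growth

theorem strictMono_snoc {k : ℕ} {f : Fin k → ℕ} (hf : StrictMono f) {x : ℕ}
    (hx : ∀ a, f a < x) : StrictMono (Fin.snoc f x : Fin (k + 1) → ℕ) := by
  intro a b hab
  induction b using Fin.lastCases with
  | last =>
    induction a using Fin.lastCases with
    | last => exact absurd hab (lt_irrefl _)
    | cast a => simpa using hx a
  | cast b =>
    induction a using Fin.lastCases with
    | last => exact absurd hab (Fin.castSucc_lt_last b).asymm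
    | cast a => simpa using hf (Fin.castSucc_lt_castSucc_iff.1 hab)

variable (A : ℕ → ℕ → ℕ)

theorem growth_zero_left (j c : ℕ) : growth A 0 j c = 0 := by
  rw [growth]

theorem growth_zero_right (i c : ℕ) : growth A i 0 c = 0 := by
  cases i <;> rw [growth]

theorem growth_succ (i j : ℕ) : growth A (i + 1) (j + 1) =
    growthRule (growth A i j) (growth A i (j + 1)) (growth A (i + 1) j) (A i j) := by
  rw [growth]

theorem growth_interlace (i j : ℕ) : Interlace (growth A i j) (growth A (i + 1) j) ∧
    Interlace (growth A i j) (growth A i (j + 1)) := by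
  induction i generalizing j with
  | zero =>
    have h : ∀ j, Interlace (growth A 0 j) (growth A 0 (j + 1)) := fun j c => by
      simp [growth_zero_left]
    refine ⟨?_, h j⟩
    induction j with
    | zero => intro c; simp [growth_zero_right]
    | succ j ih =>
      rw [growth_succ]
      exact (h j).growthRule ih
  | succ i ih =>
    have h : ∀ j, Interlace (growth A (i + 1) j) (growth A (i + 1) (j + 1)) := fun j => by
      rw [growth_succ A i j]
      exact (ih j).2.growthRule' (ih j).1
    refine ⟨?_, h j⟩
    induction j with
    | zero => intro c; simp [growth_zero_right]
    | succ j ih' =>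
      rw [growth_succ A (i + 1) j]
      exact (h j).growthRule ih'

theorem antitone_growth (i j : ℕ) : Antitone (growth A i j) := by
  induction i generalizing j with
  | zero => intro c d _; simp [growth_zero_left]
  | succ i ih =>
    induction j with
    | zero => intro c d _; simp [growth_zero_right]
    | succ j ih' =>
      rw [growth_succ]
      exact antitone_growthRule (growth_interlace A i j).2 (growth_interlace A i j).1
        (ih j) (ih (j + 1)) ih'

theorem eventually_growth (i j : ℕ) : ∀ᶠ c in Filter.atTop, growth A i j c = 0 := by
  induction i generalizing j with
  | zero => simp [growth_zero_left]
  | succ i ih =>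
    induction j with
    | zero => simp [growth_zero_right]
    | succ j ih' =>
      filter_upwards [ih j, ih (j + 1), ih',
        eventually_growthCarry (a := A i j) (ih j) (ih (j + 1)) ih'] with c h1 h2 h3 h4
      simp [growth_succ, growthRule, *]

theorem eventually_sum_growth (i j : ℕ) : ∀ᶠ N in Filter.atTop,
    ∑ c ∈ Finset.range N, growth A i j c =
      ∑ x ∈ Finset.range i, ∑ y ∈ Finset.range j, A x y := by
  induction i generalizing j with
  | zero => simp [growth_zero_left]
  | succ i ih =>
    induction j with
    | zero => simp [growth_zero_right]
    | succ j ih' =>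
      filter_upwards [ih j, ih (j + 1), ih', eventually_growthCarry (a := A i j)
        (eventually_growth A i j) (eventually_growth A i (j + 1))
        (eventually_growth A (i + 1) j)] with N h1 h2 h3 h4
      have h5 := sum_growthRule (a := A i j) (growth_interlace A i j).2
        (growth_interlace A i j).1 N
      rw [h1, h2, h3, h4, ← growth_succ, Finset.sum_range_succ] at h5
      rw [Finset.sum_range_succ, Finset.sum_range_succ _ j]
      omega

theorem exists_chain_of_le_growth {i j k : ℕ} (h : k ≤ growth A i j 0) :
    ∃ R C : Fin k → ℕ, StrictMono R ∧ StrictMono C ∧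
      ∀ a, R a < i ∧ C a < j ∧ 0 < A (R a) (C a) := by
  induction i generalizing j k with
  | zero =>
    rw [growth_zero_left] at h
    obtain rfl : k = 0 := by omega
    exact ⟨Fin.elim0, Fin.elim0, fun a => a.elim0, fun a => a.elim0, fun a => a.elim0⟩
  | succ i ih =>
    induction j generalizing k with
    | zero =>
      rw [growth_zero_right] at h
      obtain rfl : k = 0 := by omega
      exact ⟨Fin.elim0, Fin.elim0, fun a => a.elim0, fun a => a.elim0, fun a => a.elim0⟩
    | succ j ih' =>
      by_cases h1 : k ≤ growth A i (j + 1) 0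
      · obtain ⟨R, C, hR, hC, h⟩ := ih h1
        exact ⟨R, C, hR, hC, fun a => ⟨by have := h a; omega, (h a).2⟩⟩
      by_cases h2 : k ≤ growth A (i + 1) j 0
      · obtain ⟨R, C, hR, hC, h⟩ := ih' h2
        exact ⟨R, C, hR, hC, fun a => ⟨(h a).1, by have := h a; omega, (h a).2.2⟩⟩
      rw [growth_succ, growthRule, growthCarry] at h
      split_ifs at h with h3 h4
      · obtain rfl | ⟨k, rfl⟩ : k = 0 ∨ ∃ l, k = l + 1 := by
          cases k
          · exact Or.inl rfl
          · exact Or.inr ⟨_, rfl⟩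
        · omega
        obtain ⟨R, C, hR, hC, h⟩ := ih (j := j) (k := k) (by omega)
        refine ⟨Fin.snoc R i, Fin.snoc C j, ?_, ?_, ?_⟩
        · exact strictMono_snoc hR fun a => (h a).1
        · exact strictMono_snoc hC fun a => (h a).2.1
        · intro a
          induction a using Fin.lastCases with
          | last => simpa using h4
          | cast a =>
            have := h a
            simp only [Fin.snoc_castSucc]
            omega
      · omega
      · omega

theorem growth_injective {A B : ℕ → ℕ → ℕ} {m n : ℕ}
    (h1 : ∀ i ≤ m, growth A i n = growth B i n) (h2 : ∀ j ≤ n, growth A m j = growth B m j) :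
    ∀ i < m, ∀ j < n, A i j = B i j := by
  have step : ∀ i j, growth A (i + 1) (j + 1) = growth B (i + 1) (j + 1) →
      growth A i (j + 1) = growth B i (j + 1) → growth A (i + 1) j = growth B (i + 1) j →
      growth A i j = growth B i j ∧ A i j = B i j := by
    intro i j e1 e2 e3
    have hA := growth_interlace A i j
    have hB := growth_interlace B i j
    rw [← e2, ← e3] at hB
    rw [growth_succ, growth_succ, ← e2, ← e3] at e1
    exact growthRule_injective (eventually_growth A i j) (eventually_growth B i j)
      (eventually_growth A _ _) (eventually_growth A _ _) hA.2 hA.1 hB.2 hB.1 e1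
  have key : ∀ i, i ≤ m → ∀ j ≤ n, growth A i j = growth B i j := by
    intro i hi
    induction hi using Nat.decreasingInduction with
    | self => exact h2
    | of_succ i hi ih =>
      intro j hj
      induction hj using Nat.decreasingInduction with
      | self => exact h1 i hi.le
      | of_succ j hj ih' => exact (step i j (ih _ hj) ih' (ih _ hj.le)).1
  exact fun i hi j hj => (step i j (key _ hi _ hj) (key _ hi.le _ hj) (key _ hi _ hj.le)).2

end Growth

theorem eq_of_antitone_of_sum_eq {x y : ℕ → ℕ} (hx : Antitone x) (hy : Antitone y) {J : ℕ}
    (hxJ : ∀ c, J ≤ c → x c = 0) (hyJ : ∀ c, J ≤ c → y c = 0)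
    (h : ∀ p, ∑ c ∈ Finset.range J, (if p + 1 ≤ x c then 1 else 0 : ℤ) =
      ∑ c ∈ Finset.range J, (if p + 1 ≤ y c then 1 else 0 : ℤ)) : x = y := by
  have key : ∀ {x y : ℕ → ℕ}, Antitone x → Antitone y → (∀ c, J ≤ c → y c = 0) →
      (∀ p, ∑ c ∈ Finset.range J, (if p + 1 ≤ x c then 1 else 0 : ℤ) =
        ∑ c ∈ Finset.range J, (if p + 1 ≤ y c then 1 else 0 : ℤ)) → ∀ c, y c ≤ x c := by
    intro x y hx hy hyJ h c
    by_contra! hc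
    have h1 := h (x c)
    rw [Finset.sum_boole, Finset.sum_boole, Nat.cast_inj] at h1
    have h2 : (Finset.range J).filter (fun d => x c + 1 ≤ x d) ⊆ Finset.range c := by
      intro d hd
      rw [Finset.mem_filter] at hd
      rw [Finset.mem_range]
      by_contra! h2
      have := hx h2
      omega
    have h3 : Finset.range (c + 1) ⊆ (Finset.range J).filter (fun d => x c + 1 ≤ y d) := by
      intro d hd
      rw [Finset.mem_range] at hd
      have h4 : y c ≤ y d := hy (by omega)
      rw [Finset.mem_filter, Finset.mem_range]
      refine ⟨?_, by omega⟩
      by_contra! h5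
      have := hyJ d h5
      omega
    have h2 := Finset.card_le_card h2
    have h3 := Finset.card_le_card h3
    rw [Finset.card_range] at h2 h3
    omega
  exact funext fun c => le_antisymm (key hy hx hxJ (fun p => (h p).symm) c) (key hx hy hyJ h c)

/-- The values of `R` are the positions of the steps of `u`. -/
def IsSteps (u : ℕ → ℕ) {m : ℕ} (R : Fin (u m) → Fin m) : Prop :=
  ∀ k, u (R k) = k ∧ u (R k + 1) = k + 1

section Steps

variable {u : ℕ → ℕ} {m : ℕ}

theorem exists_isSteps (hu0 : u 0 = 0) (hu : ∀ i, u i ≤ u (i + 1) ∧ u (i + 1) ≤ u i + 1) (m : ℕ) :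
    ∃ R : Fin (u m) → Fin m, IsSteps u R := by
  suffices h : ∀ m, ∀ k : Fin (u m), ∃ i : Fin m, u i = k ∧ u (i + 1) = k + 1 by
    choose R hR using h m
    exact ⟨R, hR⟩
  intro m
  induction m with
  | zero => exact fun k => absurd k.2 (by omega)
  | succ m ih =>
    intro ⟨k, hk⟩
    by_cases h : k < u m
    · obtain ⟨i, hi⟩ := ih ⟨k, h⟩
      exact ⟨i.castSucc, hi⟩
    · have := hu m
      exact ⟨Fin.last m, by simp only [Fin.val_last]; omega, by simp only [Fin.val_last]; omega⟩

theorem IsSteps.strictMono {R : Fin (u m) → Fin m} (hR : IsSteps u R) (hu : Monotone u) :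
    StrictMono R := by
  intro a b hab
  by_contra! h
  have h1 : u (R b) ≤ u (R a) := hu h
  rw [(hR a).1, (hR b).1] at h1
  exact absurd hab (not_lt.2 h1)

theorem IsSteps.sum_eq {R : Fin (u m) → Fin m} (hR : IsSteps u R) (hu : Monotone u) {i : ℕ}
    (hi : i < m) (j : ℕ) : ∑ a, (if (R a : ℕ) = i ∧ (a : ℕ) < j then 1 else 0 : ℤ) =
      if u i < j ∧ u (i + 1) = u i + 1 then 1 else 0 := by
  have h1 : ∀ a, (R a : ℕ) = i → u i = a ∧ u (i + 1) = u i + 1 := by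
    rintro a rfl
    have := hR a
    omega
  by_cases h2 : u (i + 1) = u i + 1
  · have h3 : u i < u m := by
      have : u (i + 1) ≤ u m := hu hi
      omega
    have h4 : (R ⟨u i, h3⟩ : ℕ) = i := by
      obtain ⟨h5, h6⟩ := hR ⟨u i, h3⟩
      simp only at h5 h6
      by_contra h7
      rcases lt_or_gt_of_ne h7 with h8 | h8
      · have : u (R ⟨u i, h3⟩ + 1) ≤ u i := hu h8
        omega
      · have : u (i + 1) ≤ u (R ⟨u i, h3⟩) := hu h8
        omega
    rw [Finset.sum_eq_single_of_mem ⟨u i, h3⟩ (Finset.mem_univ _)]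
    · simp [h4, h2]
    · intro b _ hb
      rw [if_neg]
      rintro ⟨h5, -⟩
      exact hb (Fin.ext (h1 b h5).1.symm)
  · rw [if_neg fun h => h2 h.2]
    exact Finset.sum_eq_zero fun a _ => if_neg fun h => h2 (h1 a h.1).2

/-- A family of columns of a standard filling is determined by its leading exponents. -/
theorem eq_of_sum_lowLead_eq (hm : 0 < m) (sd : Bool) {J : ℕ} {u v : ℕ → ℕ → ℕ}
    {R : ∀ c, Fin (u c m) → Fin m} {S : ∀ c, Fin (v c m) → Fin m}
    (hu : ∀ c i, u c i ≤ u c (i + 1) ∧ u c (i + 1) ≤ u c i + 1)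
    (hv : ∀ c i, v c i ≤ v c (i + 1) ∧ v c (i + 1) ≤ v c i + 1)
    (hu0 : ∀ c, u c 0 = 0) (hv0 : ∀ c, v c 0 = 0)
    (hR : ∀ c, IsSteps (u c) (R c)) (hS : ∀ c, IsSteps (v c) (S c))
    (hua : ∀ i, Antitone fun c => u c i) (hva : ∀ i, Antitone fun c => v c i)
    (huJ : ∀ c, J ≤ c → u c m = 0) (hvJ : ∀ c, J ≤ c → v c m = 0)
    (h : ∀ x, (∑ c ∈ Finset.range J, ∑ a, lowLead sd m (R c a) a) (sd, x) =
      (∑ c ∈ Finset.range J, ∑ a, lowLead sd m (S c a) a) (sd, x)) :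
    ∀ i ≤ m, ∀ c, u c i = v c i := by
  have hum : ∀ c, Monotone (u c) := fun c => monotone_nat_of_le_succ fun i => (hu c i).1
  have hvm : ∀ c, Monotone (v c) := fun c => monotone_nat_of_le_succ fun i => (hv c i).1
  obtain ⟨r, rfl⟩ : ∃ r, m = r + 1 := ⟨m - 1, by omega⟩
  simp only [Finsupp.finsetSum_apply] at h
  have hE : ∀ i < r + 1, ∀ j,
      ∑ c ∈ Finset.range J, (if u c i < j ∧ u c (i + 1) = u c i + 1 then 1 else 0 : ℤ) =
      ∑ c ∈ Finset.range J, (if v c i < j ∧ v c (i + 1) = v c i + 1 then 1 else 0 : ℤ) := by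
    intro i hi j
    simp only [← (hR _).sum_eq (hum _) hi, ← (hS _).sum_eq (hvm _) hi]
    by_cases hj : j ≤ i
    · have h1 := h (true, r + 1 - 1 - (i - j), j)
      have e : ∀ {h : ℕ} {R : Fin h → Fin (r + 1)}, StrictMono R → ∀ a,
          lowLead sd (r + 1) (R a) a (sd, true, r + 1 - 1 - (i - j), j) =
            if (R a : ℕ) = i ∧ (a : ℕ) < j then 1 else 0 := by
        intro h R hR a
        rw [lowLead_apply_true _ _ _ _ _ _ (by omega) (val_le_of_strictMono hR a)]
        simp only [show j + (i - j) = i by omega]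
      simpa only [e ((hR _).strictMono (hum _)), e ((hS _).strictMono (hvm _))] using h1
    · have h1 := congrArg₂ (· + ·) (h (true, r + 1 - 1 - 0, i)) (h (false, r, i))
      simp only [← Finset.sum_add_distrib] at h1
      have e : ∀ {h : ℕ} {R : Fin h → Fin (r + 1)}, StrictMono R → ∀ a,
          lowLead sd (r + 1) (R a) a (sd, true, r + 1 - 1 - 0, i) +
            lowLead sd (r + 1) (R a) a (sd, false, r, i) =
            if (R a : ℕ) = i ∧ (a : ℕ) < j then 1 else 0 := by
        intro h R hR a
        have := val_le_of_strictMono hR a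
        rw [lowLead_apply_true _ _ _ _ _ _ (by omega) this, lowLead_apply_false _ _ _ _ _ this]
        split_ifs <;> omega
      simpa only [e ((hR _).strictMono (hum _)), e ((hS _).strictMono (hvm _))] using h1
  have hL : ∀ i ≤ r + 1, ∀ p, ∑ c ∈ Finset.range J, (if p + 1 ≤ u c i then 1 else 0 : ℤ) =
      ∑ c ∈ Finset.range J, (if p + 1 ≤ v c i then 1 else 0 : ℤ) := by
    intro i hi p
    induction i with
    | zero => simp [hu0, hv0]
    | succ i ih =>
      have e : ∀ {u : ℕ → ℕ → ℕ}, (∀ c i, u c i ≤ u c (i + 1) ∧ u c (i + 1) ≤ u c i + 1) →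
          ∑ c ∈ Finset.range J, (if p + 1 ≤ u c (i + 1) then 1 else 0 : ℤ) =
          ∑ c ∈ Finset.range J, (if p + 1 ≤ u c i then 1 else 0 : ℤ) +
          ∑ c ∈ Finset.range J, (if u c i < p + 1 ∧ u c (i + 1) = u c i + 1 then 1 else 0 : ℤ) -
          ∑ c ∈ Finset.range J, (if u c i < p ∧ u c (i + 1) = u c i + 1 then 1 else 0 : ℤ) := by
        intro u hu
        rw [← Finset.sum_add_distrib, ← Finset.sum_sub_distrib]
        refine Finset.sum_congr rfl fun c _ => ?_
        have := hu c i
        split_ifs <;> omega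
      rw [e hu, e hv, ih (by omega), hE i (by omega), hE i (by omega)]
  intro i hi c
  exact congrFun (eq_of_antitone_of_sum_eq (hua i) (hva i)
    (fun c hc => Nat.le_zero.1 ((hum c hi).trans (huJ c hc).le))
    (fun c hc => Nat.le_zero.1 ((hvm c hi).trans (hvJ c hc).le)) (hL i hi)) c

end Steps

section GrowthLead

variable (A : ℕ → ℕ → ℕ) (m n : ℕ)

theorem exists_growthRow (c : ℕ) :
    ∃ R : Fin (growth A m n c) → Fin m, IsSteps (fun i => growth A i n c) R :=
  exists_isSteps (u := fun i => growth A i n c) (growth_zero_left A n c)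
    (fun i => (growth_interlace A i n).1 c) m

theorem exists_growthCol (c : ℕ) :
    ∃ C : Fin (growth A m n c) → Fin n, IsSteps (fun j => growth A m j c) C :=
  exists_isSteps (u := fun j => growth A m j c) (growth_zero_right A m c)
    (fun j => (growth_interlace A m j).2 c) n

/-- The `c`-th column of the recording tableau of `A`. -/
def growthRow (c : ℕ) : Fin (growth A m n c) → Fin m := (exists_growthRow A m n c).choose

/-- The `c`-th column of the insertion tableau of `A`. -/
def growthCol (c : ℕ) : Fin (growth A m n c) → Fin n := (exists_growthCol A m n c).choose

theorem isSteps_growthRow (c : ℕ) : IsSteps (fun i => growth A i n c) (growthRow A m n c) :=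
  (exists_growthRow A m n c).choose_spec

theorem isSteps_growthCol (c : ℕ) : IsSteps (fun j => growth A m j c) (growthCol A m n c) :=
  (exists_growthCol A m n c).choose_spec

theorem strictMono_growthRow (c : ℕ) : StrictMono (growthRow A m n c) :=
  (isSteps_growthRow A m n c).strictMono
    (monotone_nat_of_le_succ fun i => ((growth_interlace A i n).1 c).1)

theorem strictMono_growthCol (c : ℕ) : StrictMono (growthCol A m n c) :=
  (isSteps_growthCol A m n c).strictMono
    (monotone_nat_of_le_succ fun j => ((growth_interlace A m j).2 c).1)

/-- The leading exponent of the product of quantum minors attached to `A`. -/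
def growthLead (J : ℕ) : TVar →₀ ℤ :=
  ∑ c ∈ Finset.range J, minorLead m n (growthRow A m n c) (growthCol A m n c)

variable {A m n}

theorem growthLead_apply (J : ℕ) (x : Bool × ℕ × ℕ) :
    growthLead A m n J (false, x) =
        (∑ c ∈ Finset.range J, ∑ a, lowLead false m (growthRow A m n c a) a) (false, x) ∧
      growthLead A m n J (true, x) =
        (∑ c ∈ Finset.range J, ∑ a, lowLead true n (growthCol A m n c a) a) (true, x) := by
  simp [growthLead, minorLead, lowLead_apply_eq_zero]

theorem growthLead_injective (hm : 0 < m) (hn : 0 < n) {B : ℕ → ℕ → ℕ} {J : ℕ}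
    (hA : ∀ c, J ≤ c → growth A m n c = 0) (hB : ∀ c, J ≤ c → growth B m n c = 0)
    (h : growthLead A m n J = growthLead B m n J) : ∀ i < m, ∀ j < n, A i j = B i j := by
  refine growth_injective (fun i hi => funext fun c => ?_) (fun j hj => funext fun c => ?_)
  · exact eq_of_sum_lowLead_eq (u := fun c i => growth A i n c) (v := fun c i => growth B i n c)
      hm false (fun c i => (growth_interlace A i n).1 c) (fun c i => (growth_interlace B i n).1 c)
      (fun c => growth_zero_left A n c) (fun c => growth_zero_left B n c)
      (isSteps_growthRow A m n) (isSteps_growthRow B m n) (fun i => antitone_growth A i n)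
      (fun i => antitone_growth B i n) hA hB
      (fun x => by rw [← (growthLead_apply J x).1, h, (growthLead_apply J x).1]) i hi c
  · exact eq_of_sum_lowLead_eq (u := fun c j => growth A m j c) (v := fun c j => growth B m j c)
      hn true (fun c j => (growth_interlace A m j).2 c) (fun c j => (growth_interlace B m j).2 c)
      (fun c => growth_zero_right A m c) (fun c => growth_zero_right B m c)
      (isSteps_growthCol A m n) (isSteps_growthCol B m n) (fun j => antitone_growth A m j)
      (fun j => antitone_growth B m j) hA hB
      (fun x => by rw [← (growthLead_apply J x).2, h, (growthLead_apply J x).2]) j hj c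

end GrowthLead

/-- The product of the entries of the matrix `z` along a list of positions. -/
def word {W : Type} [Monoid W] {κ ν : Type} (z : κ → ν → W) (l : List (κ × ν)) : W :=
  (l.map fun p => z p.1 p.2).prod

/-- The weight of a list of positions. -/
def wordWt {m n : ℕ} (l : List (Fin m × Fin n)) : ℕ := (l.map fun p => (p.1 : ℕ) * p.2).sum

/-- The span of the words of length `d` and weight less than `w`. -/
def lowSpan (K : Type) [Field K] {W : Type} [Ring W] [Algebra K W] {m n : ℕ}
    (z : Fin m → Fin n → W) (d w : ℕ) : Submodule K W :=
  Submodule.span K (word z '' {l | l.length = d ∧ wordWt l < w})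

section Words

variable {K : Type} [Field K] {q : K} {W : Type} [Ring W] [Algebra K W] {m n : ℕ}
  {z : Fin m → Fin n → W}

theorem word_append (l l' : List (Fin m × Fin n)) : word z (l ++ l') = word z l * word z l' := by
  simp [word]

theorem wordWt_append (l l' : List (Fin m × Fin n)) :
    wordWt (l ++ l') = wordWt l + wordWt l' := by
  simp [wordWt]

theorem List.Perm.wordWt_eq {l l' : List (Fin m × Fin n)} (h : l.Perm l') :
    wordWt l = wordWt l' :=
  (h.map _).sum_eq

theorem word_mem_lowSpan {d w : ℕ} {l : List (Fin m × Fin n)} (hl : l.length = d)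
    (hw : wordWt l < w) : word z l ∈ lowSpan K z d w :=
  Submodule.subset_span ⟨l, ⟨hl, hw⟩, rfl⟩

theorem word_mul_mem_lowSpan {d w : ℕ} {x : W} (hx : x ∈ lowSpan K z d w)
    (l : List (Fin m × Fin n)) :
    word z l * x ∈ lowSpan K z (l.length + d) (wordWt l + w) := by
  induction hx using Submodule.span_induction with
  | mem x hx =>
    obtain ⟨l', ⟨h1, h2⟩, rfl⟩ := hx
    rw [← word_append]
    exact word_mem_lowSpan (by simp [h1]) (by rw [wordWt_append]; omega)
  | zero => simp
  | add x y _ _ hx hy => rw [mul_add]; exact add_mem hx hy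
  | smul c x _ hx => rw [mul_smul_comm]; exact Submodule.smul_mem _ c hx

theorem mul_word_mem_lowSpan {d w : ℕ} {x : W} (hx : x ∈ lowSpan K z d w)
    (l : List (Fin m × Fin n)) :
    x * word z l ∈ lowSpan K z (d + l.length) (w + wordWt l) := by
  induction hx using Submodule.span_induction with
  | mem x hx =>
    obtain ⟨l', ⟨h1, h2⟩, rfl⟩ := hx
    rw [← word_append]
    exact word_mem_lowSpan (by simp [h1]) (by rw [wordWt_append]; omega)
  | zero => simp
  | add x y _ _ hx hy => rw [add_mul]; exact add_mem hx hy
  | smul c x _ hx => rw [smul_mul_assoc]; exact Submodule.smul_mem _ c hx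

theorem word_swap (hq : q ≠ 0) (hz : IsQMat q z) (p p' : Fin m × Fin n) :
    ∃ c : K, word z [p, p'] - c • word z [p', p] ∈ lowSpan K z 2 (wordWt [p, p']) := by
  obtain ⟨i, j⟩ := p
  obtain ⟨k, l⟩ := p'
  simp only [word, List.map_cons, List.map_nil, List.prod_cons, List.prod_nil, mul_one]
  have key : ∀ (i k : Fin m) (j l : Fin n), i < k → j < l →
      z i l * z k j ∈ lowSpan K z 2 (wordWt [(i, j), (k, l)]) := by
    intro i k j l h1 h2
    have := word_mem_lowSpan (K := K) (z := z) (l := [(i, l), (k, j)]) rfl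
      (w := wordWt [(i, j), (k, l)]) (by
        simp only [wordWt, List.map_cons, List.map_nil, List.sum_cons, List.sum_nil, add_zero]
        rw [Fin.lt_def] at h1 h2
        nlinarith)
    simpa [word] using this
  rcases lt_trichotomy i k with hik | rfl | hik <;> rcases lt_trichotomy j l with hjl | rfl | hjl
  · refine ⟨1, ?_⟩
    rw [hz.quantum hik hjl, one_smul, add_sub_cancel_left]
    exact Submodule.smul_mem _ _ (key i k j l hik hjl)
  · exact ⟨q, by simp [hz.col hik]⟩
  · exact ⟨1, by simp [hz.comm hik hjl]⟩
  · exact ⟨q, by simp [hz.row hjl]⟩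
  · exact ⟨1, by simp⟩
  · exact ⟨q⁻¹, by simp [hz.row hjl, smul_smul, inv_mul_cancel₀ hq]⟩
  · exact ⟨1, by simp [hz.comm hik hjl]⟩
  · exact ⟨q⁻¹, by simp [hz.col hik, smul_smul, inv_mul_cancel₀ hq]⟩
  · refine ⟨1, ?_⟩
    rw [hz.quantum hik hjl, one_smul, sub_add_cancel_left, (List.Perm.swap _ _ _).wordWt_eq]
    exact Submodule.neg_mem _ (Submodule.smul_mem _ _ (key k i l j hik hjl))

theorem word_perm (hq : q ≠ 0) (hz : IsQMat q z) {l l' : List (Fin m × Fin n)} (h : l.Perm l') :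
    ∃ c : K, word z l - c • word z l' ∈ lowSpan K z l.length (wordWt l) := by
  induction h with
  | nil => exact ⟨1, by simp⟩
  | @cons p l l' _ ih =>
    obtain ⟨c, hc⟩ := ih
    refine ⟨c, ?_⟩
    have := word_mul_mem_lowSpan hc [p]
    rwa [mul_sub, mul_smul_comm, ← word_append, ← word_append, ← List.length_append,
      ← wordWt_append] at this
  | swap p p' l =>
    obtain ⟨c, hc⟩ := word_swap hq hz p' p
    refine ⟨c, ?_⟩
    have := mul_word_mem_lowSpan hc l
    rw [sub_mul, smul_mul_assoc, ← word_append, ← word_append, ← wordWt_append] at this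
    rwa [add_comm] at this
  | trans h1 _ ih1 ih2 =>
    obtain ⟨c, hc⟩ := ih1
    obtain ⟨d, hd⟩ := ih2
    refine ⟨c * d, ?_⟩
    rw [← h1.length_eq, ← h1.wordWt_eq] at hd
    have := add_mem hc (Submodule.smul_mem _ c hd)
    rwa [smul_sub, smul_smul, sub_add_sub_cancel] at this

theorem word_ofFn {h : ℕ} (p : Fin h → Fin m × Fin n) :
    word z (List.ofFn p) = (List.ofFn fun a => z (p a).1 (p a).2).prod := by
  rw [word, List.map_ofFn]; rfl

theorem qAlt_sub_word_mem_lowSpan (q : K) {h : ℕ} {R : Fin h → Fin m} {C : Fin h → Fin n}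
    (hR : StrictMono R) (hC : StrictMono C) :
    qAlt q z R C - word z (List.ofFn fun a => (R a, C a)) ∈
      lowSpan K z h (wordWt (List.ofFn fun a => (R a, C a))) := by
  rw [qAlt, ← Finset.add_sum_erase _ _ (Finset.mem_univ (1 : Equiv.Perm (Fin h)))]
  have h1 : invCount (1 : Equiv.Perm (Fin h)) = 0 := by
    rw [invCount, Finset.card_eq_zero, Finset.filter_eq_empty_iff]
    rintro ⟨a, b⟩ -
    simpa using le_of_lt
  rw [h1, pow_zero, one_smul, word_ofFn, Equiv.Perm.coe_one]
  simp only [id_eq, add_sub_cancel_left]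
  refine Submodule.sum_mem _ fun σ hσ => Submodule.smul_mem _ _ ?_
  rw [← word_ofFn (z := z) fun a => (R a, C (σ a))]
  refine word_mem_lowSpan (by simp) ?_
  simp only [wordWt, List.map_ofFn, List.sum_ofFn, Function.comp_apply]
  have hm : Monovary (fun a => (R a : ℕ)) fun a => (C a : ℕ) := fun a b hab =>
    hR.monotone (hC.lt_iff_lt.1 hab).le
  refine (hm.sum_mul_comp_perm_lt_sum_mul_iff (σ := σ)).2 fun hσ' => (Finset.mem_erase.1 hσ).1 ?_
  have h2 : StrictMono σ := by
    intro a b hab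
    by_contra! h3
    have h4 := lt_of_le_of_ne h3 fun h => hab.ne' (σ.injective h)
    exact (hR hab).not_ge (hσ' (hC h4))
  have h3 : StrictMono σ.symm := fun a b hab => by
    rw [← h2.lt_iff_lt]; simpa using hab
  ext a
  have h4 := val_le_of_strictMono h2 a
  have h5 := val_le_of_strictMono h3 (σ a)
  rw [Equiv.symm_apply_apply] at h5
  exact le_antisymm h5 h4

end Words

/-- The multiset `s` of positions contains no strictly increasing chain of length `t + 1`. -/
def ChainFree {m n : ℕ} (t : ℕ) (s : Multiset (Fin m × Fin n)) : Prop :=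
  ∀ (R : Fin (t + 1) → Fin m) (C : Fin (t + 1) → Fin n), StrictMono R → StrictMono C →
    ∃ a, (R a, C a) ∉ s

section ChainFree

variable {K : Type} [Field K] {q : K} {W : Type} [Ring W] [Algebra K W] {m n t : ℕ}
  {z : Fin m → Fin n → W}

theorem word_mem_span_chainFree (hq : q ≠ 0) (hz : IsQMat q z) {I : Submodule K W}
    (hI : ∀ (R : Fin (t + 1) → Fin m) (C : Fin (t + 1) → Fin n), StrictMono R → StrictMono C →
      ∀ x, qAlt q z R C * x ∈ I) (l : List (Fin m × Fin n)) :
    word z l ∈ Submodule.span K ((fun s : Multiset (Fin m × Fin n) => word z s.toList) ''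
      {s | s.card = l.length ∧ ChainFree t s}) ⊔ I := by
  classical
  induction hw : wordWt l using Nat.strong_induction_on generalizing l with
  | _ w ih =>
    subst hw
    have hlow : lowSpan K z l.length (wordWt l) ≤
        Submodule.span K ((fun s : Multiset (Fin m × Fin n) => word z s.toList) ''
          {s | s.card = l.length ∧ ChainFree t s}) ⊔ I := by
      rw [lowSpan, Submodule.span_le]
      rintro _ ⟨l', ⟨h1, h2⟩, rfl⟩
      have := ih _ h2 l' rfl
      rwa [h1] at this
    have hperm : ∀ l', l.Perm l' → (word z l' ∈
        Submodule.span K ((fun s : Multiset (Fin m × Fin n) => word z s.toList) ''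
          {s | s.card = l.length ∧ ChainFree t s}) ⊔ I) → word z l ∈
        Submodule.span K ((fun s : Multiset (Fin m × Fin n) => word z s.toList) ''
          {s | s.card = l.length ∧ ChainFree t s}) ⊔ I := by
      intro l' h1 h2
      obtain ⟨c, hc⟩ := word_perm hq hz h1
      rw [← sub_add_cancel (word z l) (c • word z l')]
      exact add_mem (hlow hc) (Submodule.smul_mem _ c h2)
    by_cases hl : ChainFree t (l : Multiset (Fin m × Fin n))
    · refine hperm _ (Multiset.coe_eq_coe.1 (Multiset.coe_toList _).symm) ?_
      exact Submodule.mem_sup_left (Submodule.subset_span ⟨_, ⟨Multiset.coe_card l, hl⟩, rfl⟩)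
    · simp only [ChainFree, not_forall, not_exists, not_not, Multiset.mem_coe] at hl
      obtain ⟨R, C, hR, hC, hRC⟩ := hl
      have hsub : List.Subperm (List.ofFn fun a => (R a, C a)) l := by
        refine List.subperm_of_subset (List.nodup_ofFn.2 fun a b hab => ?_) ?_
        · exact hR.injective (congrArg Prod.fst hab)
        · intro x hx
          obtain ⟨a, rfl⟩ := (List.mem_ofFn' _ _).1 hx
          exact hRC a
      obtain ⟨l', h0, hl'⟩ := hsub
      obtain ⟨r, hr⟩ := hl'.exists_perm_append
      replace hr := hr.trans (h0.append_right r)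
      refine hperm _ hr ?_
      have h1 := mul_word_mem_lowSpan (K := K) (qAlt_sub_word_mem_lowSpan (z := z) q hR hC) r
      have h2 : t + 1 + r.length = l.length := by
        rw [hr.length_eq, List.length_append, List.length_ofFn]
      rw [h2, ← wordWt_append, ← hr.wordWt_eq, sub_mul, ← word_append] at h1
      have h3 := sub_mem (Submodule.mem_sup_right (hI R C hR hC (word z r))) (hlow h1)
      rwa [sub_sub_cancel] at h3

theorem qAlt_mem_span_word (q : K) {h : ℕ} (R : Fin h → Fin m) (C : Fin h → Fin n) :
    qAlt q z R C ∈ Submodule.span K (word z '' {l | l.length = h}) := by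
  refine Submodule.sum_mem _ fun σ _ => Submodule.smul_mem _ _ (Submodule.subset_span ?_)
  exact ⟨List.ofFn fun a => (R a, C (σ a)), by simp, word_ofFn _⟩

theorem prod_mem_span_word {x : ℕ → W} {h : ℕ → ℕ}
    (hx : ∀ c, x c ∈ Submodule.span K (word z '' {l | l.length = h c})) (J : ℕ) :
    ((List.range J).map x).prod ∈
      Submodule.span K (word z '' {l | l.length = ∑ c ∈ Finset.range J, h c}) := by
  induction J with
  | zero => exact Submodule.subset_span ⟨[], by simp, by simp [word]⟩
  | succ J ih =>
    rw [List.range_succ, List.map_append, List.prod_append, Finset.sum_range_succ]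
    have := Submodule.mul_mem_mul ih (hx J)
    rw [Submodule.span_mul_span] at this
    simp only [List.map_cons, List.map_nil, List.prod_cons, List.prod_nil, mul_one]
    refine Submodule.span_mono ?_ this
    rintro _ ⟨_, ⟨l, hl, rfl⟩, _, ⟨l', hl', rfl⟩, rfl⟩
    refine ⟨l ++ l', ?_, word_append _ _⟩
    simp only [Set.mem_ofPred_eq] at hl hl' ⊢
    rw [List.length_append, hl, hl']

/-- The matrix of multiplicities of a multiset of positions. -/
def multMat (s : Multiset (Fin m × Fin n)) (i j : ℕ) : ℕ :=
  (s.map fun p => ((p.1 : ℕ), (p.2 : ℕ))).count (i, j)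

theorem multMat_val (s : Multiset (Fin m × Fin n)) (i : Fin m) (j : Fin n) :
    multMat s i j = s.count (i, j) :=
  Multiset.count_map_eq_count' (fun p : Fin m × Fin n => ((p.1 : ℕ), (p.2 : ℕ))) s
    (fun p p' h => by
      simp only [Prod.mk.injEq, ← Fin.ext_iff] at h
      exact Prod.ext h.1 h.2) (i, j)

theorem sum_multMat (s : Multiset (Fin m × Fin n)) :
    ∑ i ∈ Finset.range m, ∑ j ∈ Finset.range n, multMat s i j = s.card := by
  rw [Finset.sum_range]
  simp only [Finset.sum_range, multMat_val]
  rw [← Finset.sum_product', Finset.univ_product_univ]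
  exact Multiset.sum_count_eq_card fun _ _ => Finset.mem_univ _

theorem multMat_injective {s s' : Multiset (Fin m × Fin n)}
    (h : ∀ i < m, ∀ j < n, multMat s i j = multMat s' i j) : s = s' := by
  ext ⟨i, j⟩
  rw [← multMat_val, ← multMat_val]
  exact h i i.2 j j.2

theorem ChainFree.growth_le {s : Multiset (Fin m × Fin n)} (hs : ChainFree t s) (c : ℕ) :
    growth (multMat s) m n c ≤ t := by
  refine (antitone_growth (multMat s) m n (Nat.zero_le c)).trans ?_
  by_contra! h
  obtain ⟨R, C, hR, hC, hRC⟩ := exists_chain_of_le_growth (A := multMat s) (Nat.succ_le_of_lt h)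
  obtain ⟨a, ha⟩ := hs (fun a => ⟨R a, (hRC a).1⟩) (fun a => ⟨C a, (hRC a).2.1⟩)
    (fun a b hab => hR hab) fun a b hab => hC hab
  have := (hRC a).2.2
  exact ha (Multiset.count_pos.1 (by rwa [← multMat_val]))

theorem finite_chainFree (D : ℕ) :
    {s : Multiset (Fin m × Fin n) | s.card ≤ D ∧ ChainFree t s}.Finite := by
  refine (Set.finite_Iic (D • (Finset.univ : Finset (Fin m × Fin n)).val)).subset ?_
  rintro s ⟨hs, -⟩
  rw [Set.mem_Iic, Multiset.le_iff_count]
  intro p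
  rw [Multiset.count_nsmul, Multiset.count_eq_one_of_mem (Finset.nodup _) (Finset.mem_univ _)]
  exact (Multiset.count_le_card _ _).trans (by simpa using hs)

end ChainFree

theorem mem_of_map_eq_zero_of_linearIndependent {K V W : Type} [Field K] [AddCommGroup V]
    [Module K V] [AddCommGroup W] [Module K W] {Ω : Type} [Finite Ω] {I : Submodule K V}
    {L : V →ₗ[K] W} (hI : ∀ x ∈ I, L x = 0) {e f : Ω → V}
    (hf : ∀ s, f s ∈ Submodule.span K (Set.range e) ⊔ I)
    (hLf : LinearIndependent K fun s => L (f s)) {x : V}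
    (hx : x ∈ Submodule.span K (Set.range e) ⊔ I) (hx0 : L x = 0) : x ∈ I := by
  have := Fintype.ofFinite Ω
  have h1 : ∀ y ∈ Submodule.span K (Set.range e) ⊔ I,
      L y ∈ Submodule.span K (Set.range fun s => L (e s)) := by
    intro y hy
    obtain ⟨y1, hy1, y2, hy2, rfl⟩ := Submodule.mem_sup.1 hy
    rw [map_add, hI y2 hy2, add_zero]
    have := Submodule.mem_map_of_mem (f := L) hy1
    rwa [Submodule.map_span, ← Set.range_comp] at this
  have h2 : LinearIndependent K fun s => L (e s) := by
    rw [linearIndependent_iff_card_le_finrank_span]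
    have h3 := linearIndependent_iff_card_le_finrank_span.1 hLf
    refine h3.trans ?_
    have : FiniteDimensional K (Submodule.span K (Set.range fun s => L (e s))) :=
      FiniteDimensional.span_of_finite K (Set.finite_range _)
    refine Submodule.finrank_mono (Submodule.span_le.2 ?_)
    rintro _ ⟨s, rfl⟩
    exact h1 _ (hf s)
  obtain ⟨y1, hy1, y2, hy2, rfl⟩ := Submodule.mem_sup.1 hx
  rw [map_add, hI y2 hy2, add_zero] at hx0
  obtain ⟨c, rfl⟩ := (Submodule.mem_span_range_iff_exists_fun K).1 hy1
  have h3 := Fintype.linearIndependent_iff.1 h2 c (by simpa using hx0)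
  simpa [h3] using hy2

section Presentation

variable {K : Type} [Field K] {q : K} {W : Type} [Semiring W] [Algebra K W] {u v : ℕ}

theorem isQMat_Xg (K : Type) [Field K] (q : K) (u v : ℕ) :
    IsQMat q (Xg K q : Fin u → Fin v → OqM K q u v) where
  row h := by simpa [Xg] using RingQuot.mkAlgHom_rel K (QMRel.row (K := K) (q := q) h)
  col h := by simpa [Xg] using RingQuot.mkAlgHom_rel K (QMRel.col (K := K) (q := q) h)
  comm h h' := by simpa [Xg] using RingQuot.mkAlgHom_rel K (QMRel.comm (K := K) (q := q) h h')
  quantum h h' := by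
    simpa [Xg] using RingQuot.mkAlgHom_rel K (QMRel.quantum (K := K) (q := q) h h')

theorem IsQMat.exists_algHom {y : Fin u → Fin v → W} (hy : IsQMat q y) :
    ∃ φ : OqM K q u v →ₐ[K] W, ∀ i j, φ (Xg K q i j) = y i j := by
  refine ⟨RingQuot.liftAlgHom K ⟨FreeAlgebra.lift K fun p => y p.1 p.2, ?_⟩, fun i j => ?_⟩
  · rintro _ _ (h | h | ⟨h, h'⟩ | ⟨h, h'⟩)
    · simpa using hy.row h
    · simpa using hy.col h
    · simpa using hy.comm h h'
    · simpa using hy.quantum h h'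
  · rw [Xg, RingQuot.liftAlgHom_mkAlgHom_apply, FreeAlgebra.lift_ι_apply]

theorem map_qAlt {W' : Type} [Semiring W'] [Algebra K W'] (φ : W →ₐ[K] W') {κ ν : Type}
    {z : κ → ν → W} {z' : κ → ν → W'} (h : ∀ i j, φ (z i j) = z' i j) {l : ℕ} (p : Fin l → κ)
    (C : Fin l → ν) : φ (qAlt q z p C) = qAlt q z' p C := by
  rw [qAlt, qAlt, map_sum]
  refine Finset.sum_congr rfl fun σ _ => ?_
  rw [map_smul, map_list_prod, List.map_ofFn]
  simp only [Function.comp_def, h]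

theorem OqM.induction {P : OqM K q u v → Prop} (h_algebraMap : ∀ c, P (algebraMap K _ c))
    (h_gen : ∀ i j, P (Xg K q i j)) (h_mul : ∀ x y, P x → P y → P (x * y))
    (h_add : ∀ x y, P x → P y → P (x + y)) (x : OqM K q u v) : P x := by
  obtain ⟨a, rfl⟩ := RingQuot.mkAlgHom_surjective K (QMRel K q u v) x
  induction a using FreeAlgebra.induction with
  | grade0 c => rw [AlgHom.commutes]; exact h_algebraMap c
  | grade1 p => exact h_gen p.1 p.2
  | mul a b ha hb => rw [map_mul]; exact h_mul _ _ ha hb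
  | add a b ha hb => rw [map_add]; exact h_add _ _ ha hb

theorem exists_mem_span_word (x : OqM K q u v) :
    ∃ D, x ∈ Submodule.span K (word (Xg K q) '' {l : List (Fin u × Fin v) | l.length ≤ D}) := by
  have hmono : ∀ {D D' : ℕ}, D ≤ D' →
      Submodule.span K (word (Xg K q) '' {l : List (Fin u × Fin v) | l.length ≤ D}) ≤
        Submodule.span K (word (Xg K q) '' {l : List (Fin u × Fin v) | l.length ≤ D'}) :=
    fun h => Submodule.span_mono (Set.image_mono fun _ hl => le_trans hl h)
  induction x using OqM.induction with
  | h_algebraMap c =>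
    refine ⟨0, ?_⟩
    rw [Algebra.algebraMap_eq_smul_one]
    exact Submodule.smul_mem _ _ (Submodule.subset_span ⟨[], by simp, by simp [word]⟩)
  | h_gen i j => exact ⟨1, Submodule.subset_span ⟨[(i, j)], by simp, by simp [word]⟩⟩
  | h_mul x y hx hy =>
    obtain ⟨D, hx⟩ := hx
    obtain ⟨D', hy⟩ := hy
    refine ⟨D + D', ?_⟩
    have := Submodule.mul_mem_mul hx hy
    rw [Submodule.span_mul_span] at this
    refine Submodule.span_mono ?_ this
    rintro _ ⟨_, ⟨l, hl, rfl⟩, _, ⟨l', hl', rfl⟩, rfl⟩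
    exact ⟨l ++ l', by simpa using add_le_add hl hl', word_append _ _⟩
  | h_add x y hx hy =>
    obtain ⟨D, hx⟩ := hx
    obtain ⟨D', hy⟩ := hy
    exact ⟨max D D', add_mem (hmono (le_max_left _ _) hx) (hmono (le_max_right _ _) hy)⟩

end Presentation

theorem injective_of_map_eq_zero {K A B : Type} [Field K] [Semiring A] [Algebra K A] [Semiring B]
    [Algebra K B] (f : A →ₐ[K] B) (hf : ∀ x, f x = 0 → x = 0) : Function.Injective f := by
  let := Algebra.semiringToRing K (A := A)
  let := Algebra.semiringToRing K (A := B)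
  exact (injective_iff_map_eq_zero f).2 hf

theorem isDomain_of_algebra (K A : Type) [Field K] [Semiring A] [Algebra K A] [Nontrivial A]
    [NoZeroDivisors A] : IsDomain A := by
  let := Algebra.semiringToRing K (A := A)
  exact NoZeroDivisors.to_isDomain A

section Kernel

variable {K : Type} [Field K] {q : K} {m n t : ℕ}

/-- The representation of `O_q(M_{m,t}) ⊗ O_q(M_{t,n})` on the quantum torus. -/
theorem exists_torusHom (hq : q ≠ 0) (m n t : ℕ) :
    ∃ Φ : OqM K q m t ⊗[K] OqM K q t n →ₐ[K] Module.End K ((TVar →₀ ℤ) →₀ K),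
      ∀ (i : Fin m) (j : Fin n),
        Φ (∑ k : Fin t, Xg K q i k ⊗ₜ[K] Xg K q k j) = torusMat q m n t i j := by
  obtain ⟨φ, hφ⟩ := (isQMat_lowMat hq false m m t).exists_algHom
  obtain ⟨ψ, hψ⟩ := (isQMat_lowMat hq true n n t).transpose.exists_algHom
  have h : ∀ x y, Commute (φ x) (ψ y) := by
    intro x y
    induction x using OqM.induction with
    | h_algebraMap c => rw [AlgHom.commutes]; exact Algebra.commutes c _
    | h_mul x x' hx hx' => rw [map_mul]; exact hx.mul_left hx'
    | h_add x x' hx hx' => rw [map_add]; exact hx.add_left hx'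
    | h_gen i j =>
      rw [hφ]
      induction y using OqM.induction with
      | h_algebraMap c => rw [AlgHom.commutes]; exact (Algebra.commutes c _).symm
      | h_mul x x' hx hx' => rw [map_mul]; exact hx.mul_right hx'
      | h_add x x' hx hx' => rw [map_add]; exact hx.add_right hx'
      | h_gen k l => rw [hψ]; exact (lowMat_commute_lowMat hq _ _ _ _ _ _).symm
  refine ⟨Algebra.TensorProduct.lift φ ψ h, fun i j => ?_⟩
  simp only [map_sum, Algebra.TensorProduct.lift_tmul, hφ, hψ, torusMat]

theorem torusMat_mem_span_monOp (hq : q ≠ 0) (i : Fin m) (j : Fin n) :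
    torusMat q m n t i j ∈ Submodule.span K (Set.range (monOp q tForm)) := by
  refine Submodule.sum_mem _ fun k _ => ?_
  have := wtSpan_mul hq (lowMat_mem_wtSpan hq false k i.2) (lowMat_mem_wtSpan hq true k j.2)
  exact Submodule.span_mono (Set.image_subset_range _ _) this

theorem mem_span_monOp (hq : q ≠ 0)
    {Θ : OqM K q m n →ₐ[K] Module.End K ((TVar →₀ ℤ) →₀ K)}
    (hΘ : ∀ i j, Θ (Xg K q i j) = torusMat q m n t i j) (x : OqM K q m n) :
    Θ x ∈ Submodule.span K (Set.range (monOp q tForm)) := by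
  induction x using OqM.induction with
  | h_algebraMap c =>
    rw [AlgHom.commutes, Algebra.algebraMap_eq_smul_one, ← monOp_zero (q := q) (B := tForm)]
    exact Submodule.smul_mem _ _ (Submodule.subset_span ⟨_, rfl⟩)
  | h_gen i j => rw [hΘ]; exact torusMat_mem_span_monOp hq i j
  | h_mul x y hx hy =>
    rw [map_mul]
    have := Submodule.mul_mem_mul hx hy
    rw [Submodule.span_mul_span] at this
    refine Submodule.span_le.2 ?_ this
    rintro _ ⟨_, ⟨g, rfl⟩, _, ⟨h, rfl⟩, rfl⟩
    simp only [monOp_mul hq]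
    exact Submodule.smul_mem _ _ (Submodule.subset_span ⟨_, rfl⟩)
  | h_add x y hx hy => rw [map_add]; exact add_mem hx hy

theorem hasLead_prod_qAlt_growth (hq : q ≠ 0) {s : Multiset (Fin m × Fin n)}
    (hs : ChainFree t s) (J : ℕ) :
    HasLead q tForm (tWt 1) ((List.range J).map fun c => qAlt q (torusMat q m n t)
      (growthRow (multMat s) m n c) (growthCol (multMat s) m n c)).prod
      (growthLead (multMat s) m n J) :=
  hasLead_list_prod hq fun c _ => hasLead_qAlt_torusMat hq (hs.growth_le c)
    (strictMono_growthRow (multMat s) m n c) (strictMono_growthCol (multMat s) m n c)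

theorem mem_span_minorSet_of_map_eq_zero (hq : q ≠ 0) (hm : 0 < m) (hn : 0 < n)
    {Θ : OqM K q m n →ₐ[K] Module.End K ((TVar →₀ ℤ) →₀ K)}
    (hΘ : ∀ i j, Θ (Xg K q i j) = torusMat q m n t i j)
    (hI : ∀ x ∈ tsSpan K (OqM K q m n) (minorSet K q m n t), Θ x = 0)
    {x : OqM K q m n} (hx : Θ x = 0) : x ∈ tsSpan K (OqM K q m n) (minorSet K q m n t) := by
  obtain ⟨D, hD⟩ := exists_mem_span_word x
  let Ω := {s : Multiset (Fin m × Fin n) // s.card ≤ D ∧ ChainFree t s}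
  have : Finite Ω := (finite_chainFree D).to_subtype
  obtain ⟨J, hJ⟩ : ∃ J, ∀ s : Ω, (∀ c, J ≤ c → growth (multMat s.1) m n c = 0) ∧
      ∑ c ∈ Finset.range J, growth (multMat s.1) m n c = s.1.card := by
    refine (Filter.eventually_all.2 fun s : Ω => ?_ : ∀ᶠ J in Filter.atTop, ∀ s : Ω, _).exists
    simp only [← sum_multMat]
    exact (Filter.eventually_forall_ge_atTop.2 (eventually_growth _ _ _)).and
      (eventually_sum_growth _ _ _)
  set I := Submodule.span K {x : OqM K q m n | ∃ a b, ∃ s ∈ minorSet K q m n t, x = a * s * b}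
  have hmin : ∀ (R : Fin (t + 1) → Fin m) (C : Fin (t + 1) → Fin n), StrictMono R →
      StrictMono C → ∀ x, qAlt q (Xg K q) R C * x ∈ I := fun R C hR hC x =>
    Submodule.subset_span ⟨1, x, _, ⟨R, C, hR, hC, rfl⟩, by rw [one_mul]; rfl⟩
  let e : Ω → OqM K q m n := fun s => word (Xg K q) s.1.toList
  have hspan : ∀ l : List (Fin m × Fin n), l.length ≤ D →
      word (Xg K q) l ∈ Submodule.span K (Set.range e) ⊔ I := by
    intro l hl
    refine sup_le_sup_right (Submodule.span_mono ?_) I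
      (word_mem_span_chainFree hq (isQMat_Xg K q m n) hmin l)
    rintro _ ⟨s, ⟨h1, h2⟩, rfl⟩
    exact ⟨⟨s, h1.trans_le hl, h2⟩, rfl⟩
  have hspan' : Submodule.span K (word (Xg K q) '' {l : List (Fin m × Fin n) | l.length ≤ D}) ≤
      Submodule.span K (Set.range e) ⊔ I := by
    rw [Submodule.span_le]
    rintro _ ⟨l, hl, rfl⟩
    exact hspan l hl
  let f : Ω → OqM K q m n := fun s => ((List.range J).map fun c =>
    qAlt q (Xg K q) (growthRow (multMat s.1) m n c) (growthCol (multMat s.1) m n c)).prod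
  have hf : ∀ s, f s ∈ Submodule.span K (Set.range e) ⊔ I := by
    intro s
    refine hspan' (Submodule.span_mono (Set.image_mono ?_) (prod_mem_span_word
      (fun c => qAlt_mem_span_word q (growthRow (multMat s.1) m n c)
        (growthCol (multMat s.1) m n c)) J))
    intro l hl
    rw [Set.mem_ofPred_eq, (hJ s).2] at hl
    exact hl.trans_le s.2.1
  let L : OqM K q m n →ₗ[K] (TVar →₀ ℤ) →₀ K :=
    { toFun := fun x => Θ x (Finsupp.single 0 1)
      map_add' := fun x y => by rw [map_add, LinearMap.add_apply]
      map_smul' := fun c x => by rw [map_smul, LinearMap.smul_apply, RingHom.id_apply] }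
  refine mem_of_map_eq_zero_of_linearIndependent (L := L)
    (fun x hx => DFunLike.congr_fun (hI x hx) _) hf ?_ (hspan' hD) (DFunLike.congr_fun hx _)
  refine linearIndependent_of_hasLead (x := fun s => Θ (f s)) (B := tForm) (wt := tWt 1) (q := q)
    (g := fun s : Ω => growthLead (multMat s.1) m n J) ?_ fun s => ?_
  · intro s s' h
    exact Subtype.ext (multMat_injective (growthLead_injective hm hn (hJ s).1 (hJ s').1 h))
  · have := hasLead_prod_qAlt_growth (K := K) (q := q) hq s.2.2 J
    simpa only [f, map_list_prod, List.map_map, Function.comp_def,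
      map_qAlt Θ hΘ] using this

end Kernel

/-- Second Fundamental Theorem: the kernel of
`θ*_q : O_q(M_{m,n}) → O_q(M_{m,t}) ⊗ O_q(M_{t,n})`, `X_{ij} ↦ Σ_k Y_{ik} ⊗ Z_{kj}`, equals the
ideal `I_{t+1}` generated by all `(t+1) × (t+1)` quantum minors; equivalently, the induced map
`μ*_q : O_q(M_{m,n}^{≤ t}) → O_q(M_{m,t}) ⊗ O_q(M_{t,n})` is injective.  In particular
`O_q(M_{m,n}^{≤ t})` is an integral domain. -/
theorem stmt3 (K : Type) [Field K] (q : K) (hq : q ≠ 0) (m n t : ℕ)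
    (hm : 0 < m) (hn : 0 < n) (ht : 0 < t)
    (θ : OqM K q m n →ₐ[K] OqM K q m t ⊗[K] OqM K q t n)
    (hθ : ∀ (i : Fin m) (j : Fin n),
      θ (Xg K q i j) = ∑ k : Fin t, Xg K q i k ⊗ₜ[K] Xg K q k j)
    (μ : OqMle K q m n t →ₐ[K] OqM K q m t ⊗[K] OqM K q t n)
    (hμ : μ.comp (mkle K q m n t) = θ) :
    (∀ x : OqM K q m n,
        θ x = 0 ↔ x ∈ tsSpan K (OqM K q m n) (minorSet K q m n t)) ∧
    Function.Injective μ ∧ IsDomain (OqMle K q m n t) := by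
  obtain ⟨Φ, hΦ⟩ := exists_torusHom (K := K) hq m n t
  have hmk : ∀ x ∈ tsSpan K (OqM K q m n) (minorSet K q m n t), mkle K q m n t x = 0 := by
    intro x hx
    refine Submodule.span_induction (p := fun x _ => mkle K q m n t x = 0) ?_ (map_zero _)
      (fun x y _ _ hx hy => by rw [map_add, hx, hy, add_zero])
      (fun c x _ hx => by rw [map_smul, hx, smul_zero]) hx
    rintro _ ⟨a, b, s, ⟨R, C, hR, hC, rfl⟩, rfl⟩
    have := RingQuot.mkAlgHom_rel K (DetRel.minor (K := K) (q := q) R C hR hC)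
    rw [map_zero] at this
    rw [map_mul, map_mul, mkle, this, mul_zero, zero_mul]
  have hmk_surj : Function.Surjective (mkle K q m n t) := RingQuot.mkAlgHom_surjective K _
  have hμθ : ∀ x, μ (mkle K q m n t x) = θ x := fun x => DFunLike.congr_fun hμ x
  have hΘ : ∀ i j, (Φ.comp θ) (Xg K q i j) = torusMat q m n t i j := fun i j => by
    rw [AlgHom.comp_apply, hθ, hΦ]
  have hI : ∀ x ∈ tsSpan K (OqM K q m n) (minorSet K q m n t), θ x = 0 := fun x hx => by
    rw [← hμθ, hmk x hx, map_zero]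
  have hker : ∀ x, Φ (θ x) = 0 → x ∈ tsSpan K (OqM K q m n) (minorSet K q m n t) := fun x hx =>
    mem_span_minorSet_of_map_eq_zero hq hm hn hΘ
      (fun y hy => by rw [AlgHom.comp_apply, hI y hy, map_zero]) hx
  have hinj : ∀ x, Φ (μ x) = 0 → x = 0 := by
    intro x hx
    obtain ⟨x, rfl⟩ := hmk_surj x
    rw [hμθ] at hx
    exact hmk x (hker x hx)
  refine ⟨fun x => ⟨fun hx => hker x (by rw [hx, map_zero]), hI x⟩,
    injective_of_map_eq_zero μ fun x hx => hinj x (by rw [hx, map_zero]), ?_⟩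
  have hne : Nontrivial (OqMle K q m n t) := by
    refine ⟨1, 0, fun h => ?_⟩
    have := congrArg (fun x => Φ (μ x)) h
    simp at this
  have hdiv : NoZeroDivisors (OqMle K q m n t) := by
    refine ⟨fun {x y} hxy => ?_⟩
    by_contra! h
    obtain ⟨x', rfl⟩ := hmk_surj x
    obtain ⟨y', rfl⟩ := hmk_surj y
    refine mul_ne_zero_of_mem_span_monOp hq (mem_span_monOp hq hΘ x') (mem_span_monOp hq hΘ y')
      (fun h0 => h.1 (hinj _ (by rw [hμθ]; exact h0)))
      (fun h0 => h.2 (hinj _ (by rw [hμθ]; exact h0))) ?_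
    rw [← map_mul, AlgHom.comp_apply, ← hμθ, map_mul, hxy, map_zero, map_zero]
  exact isDomain_of_algebra K _

end
end
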